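/- arXiv:1401.5829 — 4 statements merged into one kernel-verified Lean document; each statement's English description precedes it below -/
import Mathlib

section
/- Let U be the unilateral shift of multiplicity one on a separable infinite-dimensional complex Hilbert space H. There is no bounded operator T on H such that for every α in [0,1], the operator αU is compalent to a reducing part of T. -/
open Filter Topology ContinuousLinearMap

/-- Conjugation of an operator by a unitary (linear isometric equivalence): `W T W*`. -/
noncomputable def conjOp {H₁ H₂ : Type*} [NormedAddCommGroup H₁] [InnerProductSpace ℂ H₁]
    [NormedAddCommGroup H₂] [InnerProductSpace ℂ H₂]
    (W : H₁ ≃ₗᵢ[ℂ] H₂) (T : H₁ →L[ℂ] H₁) : H₂ →L[ℂ] H₂ :=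
  ((W.toContinuousLinearEquiv : H₁ →L[ℂ] H₂).comp T).comp
    ((W.symm.toContinuousLinearEquiv : H₂ →L[ℂ] H₁))

/-- The restriction of an operator to an invariant subspace. -/
noncomputable def opRestrict {H : Type*} [NormedAddCommGroup H] [InnerProductSpace ℂ H]
    (T : H →L[ℂ] H) (M : Submodule ℂ H) (hM : ∀ x ∈ M, T x ∈ M) : M →L[ℂ] M :=
  { toLinearMap := (T : H →ₗ[ℂ] H).restrict hM
    cont := Continuous.subtype_mk (T.continuous.comp continuous_subtype_val) _ }

/-- Two operators (possibly on different Hilbert spaces) are *compalent* if one is a compact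
perturbation of a unitary conjugate of the other: `T₂ = W T₁ W* + K` with `K` compact. -/
def Compalent {H₁ H₂ : Type*} [NormedAddCommGroup H₁] [InnerProductSpace ℂ H₁]
    [NormedAddCommGroup H₂] [InnerProductSpace ℂ H₂]
    (T₁ : H₁ →L[ℂ] H₁) (T₂ : H₂ →L[ℂ] H₂) : Prop :=
  ∃ W : H₁ ≃ₗᵢ[ℂ] H₂, IsCompactOperator (T₂ - conjOp W T₁)

/-- `S` is compalent to a reducing part of `T`, that is, to the restriction of `T` to a closed
subspace invariant under both `T` and `T*`. -/
def CompalentToReducingPart {H : Type*} [NormedAddCommGroup H] [InnerProductSpace ℂ H]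
    [CompleteSpace H] (S T : H →L[ℂ] H) : Prop :=
  ∃ (M : Submodule ℂ H) (_ : IsClosed (M : Set H))
    (hT : ∀ x ∈ M, T x ∈ M) (_ : ∀ x ∈ M, ContinuousLinearMap.adjoint T x ∈ M),
    Compalent S (opRestrict T M hT)

lemma aux_fred {X : Type*} [NormedAddCommGroup X] [InnerProductSpace ℂ X] [CompleteSpace X]
    (S V : X →L[ℂ] X) (hV : Function.Injective V) (hV' : ¬ Function.Surjective V)
    (hc : IsCompactOperator (S - V)) : ¬ Function.Bijective S := by
  intro hS
  let E := ContinuousLinearEquiv.ofBijective S (LinearMap.ker_eq_bot.2 hS.1)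
    (LinearMap.range_eq_top.2 hS.2)
  have hE : ∀ x, E x = S x := fun x => rfl
  let C : X →L[ℂ] X := (E.symm : X →L[ℂ] X).comp (S - V)
  have hC : IsCompactOperator C := hc.clm_comp (E.symm : X →L[ℂ] X)
  have hCx : ∀ x, C x = x - E.symm (V x) := by
    intro x
    simp only [C, ContinuousLinearMap.comp_apply, _root_.sub_apply,
      ContinuousLinearEquiv.coe_coe, map_sub, ← hE, ContinuousLinearEquiv.symm_apply_apply]
  rcases hC.hasEigenvalue_or_mem_resolventSet (μ := (1:ℂ)) one_ne_zero with h | h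
  · obtain ⟨x, hx⟩ := h.exists_hasEigenvector
    have h1 := hx.apply_eq_smul
    have h2 := hCx x
    have h3 : C x = x := by simpa using h1
    rw [h3] at h2
    have h4 : E.symm (V x) = 0 := sub_eq_self.1 h2.symm
    have h5 : V x = 0 := by simpa using h4
    exact hx.2 (hV (by simpa using h5))
  · rw [spectrum.mem_resolventSet_iff, ContinuousLinearMap.isUnit_iff_bijective] at h
    apply hV'
    intro y
    obtain ⟨x, hx⟩ := h.2 (E.symm y)
    refine ⟨x, E.symm.injective ?_⟩
    rw [← hx]
    simp [hCx]

/-- finite-dimensional, and splitting `S`. -/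
def AuxR {X : Type*} [NormedAddCommGroup X] [InnerProductSpace ℂ X]
    (S : X →L[ℂ] X) (N : Submodule ℂ X) : Prop :=
  FiniteDimensional ℂ N ∧ (∀ x ∈ N, S x ∈ N) ∧ (∀ x ∈ Nᗮ, S x ∈ Nᗮ)

lemma AuxR.sup {X : Type*} [NormedAddCommGroup X] [InnerProductSpace ℂ X]
    {S : X →L[ℂ] X} {N N' : Submodule ℂ X} (h : AuxR S N) (h' : AuxR S N') :
    AuxR S (N ⊔ N') := by
  obtain ⟨h1, h2, h3⟩ := h
  obtain ⟨h1', h2', h3'⟩ := h'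
  refine ⟨inferInstance, ?_, ?_⟩
  · intro x hx
    obtain ⟨y, hy, z, hz, rfl⟩ := Submodule.mem_sup.1 hx
    rw [map_add]
    exact Submodule.add_mem_sup (h2 _ hy) (h2' _ hz)
  · intro x hx
    rw [← Submodule.inf_orthogonal] at hx ⊢
    exact ⟨h3 _ hx.1, h3' _ hx.2⟩

lemma AuxR.bot {X : Type*} [NormedAddCommGroup X] [InnerProductSpace ℂ X]
    {S : X →L[ℂ] X} : AuxR S ⊥ := by
  refine ⟨inferInstance, ?_, ?_⟩
  · intro x hx
    simp only [Submodule.mem_bot] at hx ⊢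
    simp [hx]
  · intro x _
    simp

lemma aux_dense {X : Type*} [NormedAddCommGroup X] [InnerProductSpace ℂ X] [CompleteSpace X]
    (S : X →L[ℂ] X) (h0 : ∀ x : X, (∀ N, AuxR S N → x ∈ Nᗮ) → x = 0) (z : X) (ε : ℝ) (hε : 0 < ε) :
    ∃ N, AuxR S N ∧ ∃ a ∈ N, ‖z - a‖ < ε := by
  let D : Submodule ℂ X := ⨆ N : {N // AuxR S N}, N.1
  have hD : D.topologicalClosure = ⊤ := by
    rw [Submodule.topologicalClosure_eq_top_iff, Submodule.eq_bot_iff]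
    intro x hx
    refine h0 x fun N hN => ?_
    exact Submodule.orthogonal_le (le_iSup (fun N : {N // AuxR S N} => N.1) ⟨N, hN⟩) hx
  have hz : z ∈ closure (D : Set X) := by
    rw [← Submodule.topologicalClosure_coe, hD]; trivial
  obtain ⟨a, ha, haz⟩ := Metric.mem_closure_iff.1 hz ε hε
  have : Nonempty {N // AuxR S N} := ⟨⟨⊥, AuxR.bot⟩⟩
  have hdir : Directed (· ≤ ·) (fun N : {N // AuxR S N} => N.1) := fun N N' =>
    ⟨⟨N.1 ⊔ N'.1, N.2.sup N'.2⟩, le_sup_left, le_sup_right⟩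
  obtain ⟨N, hN⟩ := (Submodule.mem_iSup_of_directed _ hdir).1 ha
  exact ⟨N.1, N.2, a, hN, by rwa [← dist_eq_norm]⟩

lemma aux_small {X : Type*} [NormedAddCommGroup X] [InnerProductSpace ℂ X] [CompleteSpace X]
    (S K : X →L[ℂ] X) (hK : IsCompactOperator K)
    (h0 : ∀ x : X, (∀ N, AuxR S N → x ∈ Nᗮ) → x = 0) (ε : ℝ) (hε : 0 < ε) :
    ∃ N, AuxR S N ∧ ∀ x ∈ Nᗮ, ‖K x‖ ≤ ε * ‖x‖ := by
  by_contra! hcon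
  let t : {N // AuxR S N} → Set X := fun N =>
    closure (K '' {x | x ∈ N.1ᗮ ∧ ‖x‖ ≤ 1}) ∩ {y | ε ≤ ‖y‖}
  have : Nonempty {N // AuxR S N} := ⟨⟨⊥, AuxR.bot⟩⟩
  have hcl : ∀ N, IsClosed (t N) := fun N =>
    isClosed_closure.inter (isClosed_le continuous_const continuous_norm)
  have hcp : ∀ N, IsCompact (t N) := by
    intro N
    refine (hK.isCompact_closure_image_closedBall (f := (K : X →ₗ[ℂ] X)) 1).of_isClosed_subset (hcl N) ?_
    refine Set.inter_subset_left.trans (closure_mono ?_)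
    rintro _ ⟨x, hx, rfl⟩
    exact ⟨x, by simpa using hx.2, rfl⟩
  have hne : ∀ N, (t N).Nonempty := by
    intro N
    obtain ⟨x, hx, hlt⟩ := hcon N.1 N.2
    have hx0 : x ≠ 0 := by
      rintro rfl
      simp at hlt
    have hpos : 0 < ‖x‖ := norm_pos_iff.2 hx0
    refine ⟨K ((‖x‖⁻¹ : ℂ) • x), subset_closure ⟨_, ⟨Submodule.smul_mem _ _ hx, ?_⟩, rfl⟩, ?_⟩
    · rw [norm_smul]
      simp [hpos.ne']
    · simp only [Set.mem_ofPred_eq, map_smul, norm_smul]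
      simp only [norm_inv, Complex.norm_real, norm_norm]
      rw [inv_mul_eq_div, le_div_iff₀ hpos]
      exact hlt.le
  have hdir : Directed (· ⊇ ·) t := by
    intro N N'
    refine ⟨⟨N.1 ⊔ N'.1, N.2.sup N'.2⟩, ?_, ?_⟩
    · refine Set.inter_subset_inter_left _ (closure_mono (Set.image_mono ?_))
      intro x hx
      exact ⟨Submodule.orthogonal_le le_sup_left hx.1, hx.2⟩
    · refine Set.inter_subset_inter_left _ (closure_mono (Set.image_mono ?_))
      intro x hx
      exact ⟨Submodule.orthogonal_le le_sup_right hx.1, hx.2⟩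
  obtain ⟨y, hy⟩ := IsCompact.nonempty_iInter_of_directed_nonempty_isCompact_isClosed t hdir hne hcp hcl
  rw [Set.mem_iInter] at hy
  have hy0 : inner ℂ y y = 0 := by
    rw [← norm_eq_zero]
    refine le_antisymm (le_of_forall_pos_le_add fun δ hδ => ?_) (norm_nonneg _)
    obtain ⟨N, hN, a, ha, haz⟩ := aux_dense S h0 (ContinuousLinearMap.adjoint K y) δ hδ
    have hsub : closure (K '' {x | x ∈ Nᗮ ∧ ‖x‖ ≤ 1}) ⊆ {w | ‖inner ℂ y w‖ ≤ δ} := by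
      apply closure_minimal
      · rintro _ ⟨x, ⟨hx, hx1⟩, rfl⟩
        simp only [Set.mem_ofPred_eq]
        rw [← ContinuousLinearMap.adjoint_inner_left]
        have h1 : inner ℂ a x = 0 := hx a ha
        have h2 : inner ℂ (ContinuousLinearMap.adjoint K y) x
            = inner ℂ (ContinuousLinearMap.adjoint K y - a) x := by
          rw [inner_sub_left, h1, sub_zero]
        rw [h2]
        calc _ ≤ ‖ContinuousLinearMap.adjoint K y - a‖ * ‖x‖ := norm_inner_le_norm _ _
          _ ≤ δ * 1 := by gcongr
          _ = δ := mul_one _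
      · exact isClosed_le (by fun_prop) continuous_const
    have := hsub (hy ⟨N, hN⟩).1
    simpa using this
  have hy1 : ε ≤ ‖y‖ := (hy ⟨⊥, AuxR.bot⟩).2
  rw [inner_self_eq_zero] at hy0
  rw [hy0, norm_zero] at hy1
  linarith

lemma aux_main {X : Type*} [NormedAddCommGroup X] [InnerProductSpace ℂ X] [CompleteSpace X]
    (S V : X →L[ℂ] X) (a : ℝ) (ha : 0 < a) (hV : ∀ x, ‖V x‖ = a * ‖x‖)
    (hV' : ¬ Function.Surjective V) (hc : IsCompactOperator (S - V)) :
    ∃ x : X, x ≠ 0 ∧ ∀ N, AuxR S N → x ∈ Nᗮ := by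
  by_contra! hcon
  have h0 : ∀ x : X, (∀ N, AuxR S N → x ∈ Nᗮ) → x = 0 := by
    intro x hx
    by_contra hx0
    obtain ⟨N, hN, h⟩ := hcon x hx0
    exact h (hx N hN)
  obtain ⟨N, hN, hs⟩ := aux_small S (S - V) hc h0 (a/2) (by positivity)
  have := hN.1
  let Q : X →L[ℂ] X := N.starProjection
  have hQm : ∀ x, Q x ∈ N := fun x => N.starProjection_apply_mem x
  have hQo : ∀ x, x - Q x ∈ Nᗮ := fun x => N.sub_starProjection_mem_orthogonal x
  let S' : X →L[ℂ] X := (a : ℂ) • Q + S.comp (1 - Q)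
  have hS' : ∀ x, S' x = (a : ℂ) • Q x + S (x - Q x) := fun x => by simp [S']
  have hlow : ∀ x, (a/2) * ‖x‖ ≤ ‖S' x‖ := by
    intro x
    have h1 : (a/2) * ‖x - Q x‖ ≤ ‖S (x - Q x)‖ := by
      have h2 := hs _ (hQo x)
      have h3 := hV (x - Q x)
      have h4 : V (x - Q x) = S (x - Q x) - (S - V) (x - Q x) := by simp
      have h5 := norm_sub_le (S (x - Q x)) ((S - V) (x - Q x))
      rw [← h4, h3] at h5
      linarith
    have h6 : inner ℂ ((a : ℂ) • Q x) (S (x - Q x)) = 0 :=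
      hN.2.2 _ (hQo x) _ (N.smul_mem _ (hQm x))
    have h7 := norm_add_sq_eq_norm_sq_add_norm_sq_of_inner_eq_zero _ _ h6
    have h8 : inner ℂ (Q x) (x - Q x) = 0 := hQo x _ (hQm x)
    have h9 := norm_add_sq_eq_norm_sq_add_norm_sq_of_inner_eq_zero _ _ h8
    rw [← hS', norm_smul, Complex.norm_real, Real.norm_of_nonneg ha.le] at h7
    rw [add_sub_cancel] at h9
    refine abs_le_of_sq_le_sq' ?_ (norm_nonneg _) |>.2
    have h10 : ((a/2) * ‖x - Q x‖)^2 ≤ ‖S (x - Q x)‖^2 := by gcongr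
    have h11 := sq_nonneg (a * ‖Q x‖)
    have h12 : (a / 2 * ‖x‖) ^ 2 = (a/2)^2 * (‖Q x‖ * ‖Q x‖ + ‖x - Q x‖ * ‖x - Q x‖) := by
      rw [← h9]; ring
    nlinarith
  have hanti : AntilipschitzWith (Real.toNNReal (a/2)⁻¹) S' := by
    apply AddMonoidHomClass.antilipschitz_of_bound
    intro x
    rw [Real.coe_toNNReal _ (by positivity), inv_mul_eq_div, le_div_iff₀ (by positivity), mul_comm]
    exact hlow x
  have hclosed : IsClosed (Set.range S') := hanti.isClosed_range S'.uniformContinuous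
  have hsub : ∀ N', AuxR S N' → ∀ y ∈ N', y ∈ Set.range S' := by
    intro N' hN' y hy
    have hR := hN.sup hN'
    have := hR.1
    have hinv : ∀ x ∈ N ⊔ N', (S' : X →ₗ[ℂ] X) x ∈ N ⊔ N' := by
      intro x hx
      have hq : Q x ∈ N ⊔ N' := (le_sup_left : N ≤ N ⊔ N') (hQm x)
      change S' x ∈ _
      rw [hS']
      exact add_mem (Submodule.smul_mem _ _ hq) (hR.2.1 _ (sub_mem hx hq))
    have hinj : Function.Injective ((S' : X →ₗ[ℂ] X).restrict hinv) := by
      intro u v huv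
      apply Subtype.ext
      apply hanti.injective
      exact congrArg Subtype.val huv
    obtain ⟨u, hu⟩ := (LinearMap.injective_iff_surjective.1 hinj) ⟨y, (le_sup_right : N' ≤ N ⊔ N') hy⟩
    exact ⟨u, congrArg Subtype.val hu⟩
  have hsurj : Function.Surjective S' := by
    intro z
    have : z ∈ closure (Set.range S') := by
      rw [Metric.mem_closure_iff]
      intro ε hε
      obtain ⟨N', hN', b, hb, hzb⟩ := aux_dense S h0 z ε hε
      exact ⟨b, hsub N' hN' b hb, by rwa [dist_eq_norm]⟩
    rwa [hclosed.closure_eq] at this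
  refine aux_fred S' V ?_ hV' ?_ ⟨hanti.injective, hsurj⟩
  · rw [injective_iff_map_eq_zero]
    intro x hx
    have := hV x
    rw [hx, norm_zero] at this
    have : ‖x‖ = 0 := by
      rcases mul_eq_zero.1 this.symm with h | h
      · exact absurd h ha.ne'
      · exact h
    exact norm_eq_zero.1 this
  · have hQc : IsCompactOperator Q := by
      have h1 : IsCompactOperator (N.orthogonalProjectionOnto) :=
        isCompactOperator_of_locallyCompactSpace_dom _
      exact h1.clm_comp N.subtypeL
    have h2 : IsCompactOperator ((S - V) + ((a : ℂ) • 1 - S).comp Q) :=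
      hc.add (hQc.clm_comp ((a : ℂ) • 1 - S : X →L[ℂ] X))
    convert h2 using 2
    ext x
    simp [S']
    abel

lemma aux_U {H : Type*} [NormedAddCommGroup H] [InnerProductSpace ℂ H] [CompleteSpace H]
    (e : HilbertBasis ℕ ℂ H) (U : H →L[ℂ] H) (hU : ∀ n : ℕ, U (e n) = e (n + 1)) :
    (∀ x y, inner ℂ (U x) (U y) = inner ℂ x y) ∧ ¬ Function.Surjective U := by
  have hext : ∀ x y : H, (∀ m, inner ℂ (e m) x = inner ℂ (e m) y) → x = y := by
    intro x y h
    apply e.repr.injective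
    ext m
    rw [e.repr_apply_apply, e.repr_apply_apply, h]
  have ho := orthonormal_iff_ite.1 e.orthonormal
  constructor
  · have h1 : (ContinuousLinearMap.adjoint U).comp U = ContinuousLinearMap.id ℂ H := by
      refine ContinuousLinearMap.ext_on (s := Set.range e) ?_ ?_
      · rw [dense_iff_closure_eq, ← Submodule.topologicalClosure_coe, e.dense_span]; rfl
      · rintro _ ⟨n, rfl⟩
        apply hext
        intro m
        simp only [ContinuousLinearMap.comp_apply, ContinuousLinearMap.id_apply]
        rw [ContinuousLinearMap.adjoint_inner_right, hU, hU, ho, ho]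
        simp
    intro x y
    rw [← ContinuousLinearMap.adjoint_inner_right]
    have := congrArg (fun L : H →L[ℂ] H => L y) h1
    simp only [ContinuousLinearMap.comp_apply, ContinuousLinearMap.id_apply] at this
    rw [this]
  · intro hs
    obtain ⟨x, hx⟩ := hs (e 0)
    have h1 : ContinuousLinearMap.adjoint U (e 0) = 0 := by
      apply hext
      intro m
      rw [ContinuousLinearMap.adjoint_inner_right, hU, ho]
      simp
    have h2 : inner ℂ (e 0) (U x) = 0 := by
      rw [← ContinuousLinearMap.adjoint_inner_left, h1, inner_zero_left]
    rw [hx, ho] at h2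
    simp at h2

lemma aux_comm {H : Type*} [NormedAddCommGroup H] [InnerProductSpace ℂ H] [CompleteSpace H]
    (T : H →L[ℂ] H) (M : Submodule ℂ H) [M.HasOrthogonalProjection]
    (hT : ∀ x ∈ M, T x ∈ M) (hT' : ∀ x ∈ M, ContinuousLinearMap.adjoint T x ∈ M) (x : H) :
    M.starProjection (T x) = T (M.starProjection x) := by
  apply Submodule.eq_starProjection_of_mem_orthogonal (hT _ (M.starProjection_apply_mem x))
  rw [← map_sub]
  intro u hu
  rw [← ContinuousLinearMap.adjoint_inner_left]
  exact M.sub_starProjection_mem_orthogonal x _ (hT' u hu)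

lemma aux_iter {H : Type*} [NormedAddCommGroup H] [InnerProductSpace ℂ H] [CompleteSpace H]
    (A L V : H →L[ℂ] H) (r : ℝ) (hr : 0 ≤ r) (hr1 : r < 1) (hL : ‖L‖ ≤ 1) (hV : ‖V‖ ≤ 1)
    (hc : IsCompactOperator (A - (r : ℂ) • (L * A * V))) : IsCompactOperator A := by
  have hn : ∀ n : ℕ, IsCompactOperator (A - (r : ℂ)^n • (L^n * A * V^n)) := by
    intro n
    induction n with
    | zero =>
      have : A - (r : ℂ)^0 • (L^0 * A * V^0) = 0 := by simp
      rw [this]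
      exact isCompactOperator_zero
    | succ n ih =>
      have h1 : IsCompactOperator (((r : ℂ) • L) * (A - (r : ℂ)^n • (L^n * A * V^n)) * V) :=
        (ih.clm_comp ((r : ℂ) • L)).comp_clm V
      have h2 : A - (r : ℂ)^(n+1) • (L^(n+1) * A * V^(n+1)) =
          (A - (r : ℂ) • (L * A * V)) + ((r : ℂ) • L) * (A - (r : ℂ)^n • (L^n * A * V^n)) * V := by
        rw [pow_succ' L, pow_succ V, pow_succ (r : ℂ)]
        simp only [mul_sub, sub_mul, smul_mul_assoc, mul_smul_comm, smul_smul, mul_assoc]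
        abel
      rw [h2]
      exact hc.add h1
  have ht : Tendsto (fun n : ℕ => A - (r : ℂ)^n • (L^n * A * V^n)) atTop (𝓝 A) := by
    have h0 : Tendsto (fun n : ℕ => (r : ℂ)^n • (L^n * A * V^n)) atTop (𝓝 0) := by
      apply squeeze_zero_norm (a := fun n => r^n * ‖A‖)
      · intro n
        rw [norm_smul, norm_pow, Complex.norm_real, Real.norm_of_nonneg hr]
        gcongr
        have hp : ∀ (B : H →L[ℂ] H), ‖B‖ ≤ 1 → ∀ C : H →L[ℂ] H, ‖B^n * C‖ ≤ ‖C‖ ∧ ‖C * B^n‖ ≤ ‖C‖ := by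
          intro B hB
          induction n with
          | zero => simp
          | succ n ih =>
            intro C
            constructor
            · rw [pow_succ, mul_assoc]
              refine (ih (B * C)).1.trans ((norm_mul_le _ _).trans ?_)
              exact mul_le_of_le_one_left (norm_nonneg _) hB
            · rw [pow_succ', ← mul_assoc]
              refine (ih (C * B)).2.trans ((norm_mul_le _ _).trans ?_)
              exact mul_le_of_le_one_right (norm_nonneg _) hB
        exact (hp V hV _).2.trans (hp L hL A).1
      · simpa using (tendsto_pow_atTop_nhds_zero_of_lt_one hr hr1).mul_const ‖A‖
    simpa using h0.const_sub A
  exact isCompactOperator_of_tendsto ht (Eventually.of_forall hn)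

lemma aux_pair {H : Type*} [NormedAddCommGroup H] [InnerProductSpace ℂ H] [CompleteSpace H]
    (T P Q V W : H →L[ℂ] H) (a b : ℝ) (ha : 0 ≤ a) (hab : a < b)
    (hQ : Q * T = T * Q) (hPV : P * V = V) (hV : ‖V‖ ≤ 1)
    (hW : ‖W‖ ≤ 1) (hWW : ContinuousLinearMap.adjoint W * W = Q)
    (hK : IsCompactOperator (T * P - (a : ℂ) • V))
    (hK' : IsCompactOperator (T * Q - (b : ℂ) • W)) : IsCompactOperator (Q * P) := by
  have hb : 0 < b := ha.trans_lt hab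
  have hb0 : (b : ℂ) ≠ 0 := by exact_mod_cast hb.ne'
  refine aux_iter (Q * P) (ContinuousLinearMap.adjoint W) V (a / b) (by positivity)
    ((div_lt_one hb).2 hab) (by rwa [LinearIsometryEquiv.norm_map]) hV ?_
  have h1 : IsCompactOperator (Q * (T * P - (a : ℂ) • V) - (T * Q - (b : ℂ) • W) * P) :=
    (hK.clm_comp Q).sub (hK'.comp_clm P)
  have h2 : IsCompactOperator (((b : ℂ)⁻¹ • ContinuousLinearMap.adjoint W) *
    (Q * (T * P - (a : ℂ) • V) - (T * Q - (b : ℂ) • W) * P)) :=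
    h1.clm_comp ((b : ℂ)⁻¹ • ContinuousLinearMap.adjoint W)
  have h3 : Q * (T * P - (a : ℂ) • V) - (T * Q - (b : ℂ) • W) * P
      = (b : ℂ) • (W * P) - (a : ℂ) • (Q * V) := by
    simp only [mul_sub, sub_mul, ← mul_assoc, hQ, smul_mul_assoc, mul_smul_comm]
    abel
  rw [h3] at h2
  convert h2 using 2
  rw [mul_assoc _ (Q * P), mul_assoc Q, hPV]
  simp only [mul_sub, smul_mul_assoc, mul_smul_comm, smul_smul, ← mul_assoc, hWW]
  rw [mul_inv_cancel₀ hb0, one_smul]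
  push_cast
  rw [div_eq_mul_inv]

lemma aux_orth {H : Type*} [NormedAddCommGroup H] [InnerProductSpace ℂ H] [CompleteSpace H]
    (T P Q : H →L[ℂ] H) (M : Submodule ℂ H) (hPM : ∀ x, P x ∈ M)
    (hP : P.IsSymmetric) (hQ : Q.IsSymmetric) (hQQ : Q * Q = Q)
    (hPT : ∀ x, P (T x) = T (P x)) (hQT : ∀ x, Q (T x) = T (Q x))
    (hPT' : ∀ x, P (ContinuousLinearMap.adjoint T x) = ContinuousLinearMap.adjoint T (P x))
    (hQT' : ∀ x, Q (ContinuousLinearMap.adjoint T x) = ContinuousLinearMap.adjoint T (Q x))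
    (hc : IsCompactOperator (Q * P)) (g : H) (hg : P g = g)
    (hgN : ∀ N : Submodule ℂ H, FiniteDimensional ℂ N → N ≤ M → (∀ x ∈ N, T x ∈ N) →
      (∀ x ∈ N, ContinuousLinearMap.adjoint T x ∈ N) → g ∈ Nᗮ) : Q g = 0 := by
  let B : H →L[ℂ] H := P * (Q * P)
  have hB : ∀ x, B x = P (Q (P x)) := fun x => rfl
  have hBc : IsCompactOperator B := hc.clm_comp P
  have hBs : B.IsSymmetric := by
    intro x y
    change inner ℂ (P (Q (P x))) y = inner ℂ x (P (Q (P y)))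
    rw [← hP.apply_clm, ← hQ.apply_clm, ← hP.apply_clm]
  have hbot := ContinuousLinearMap.orthogonalComplement_iSup_eigenspaces_eq_bot hBc hBs
  have hBg : B g = 0 := by
    rw [← Submodule.mem_bot ℂ, ← hbot, ← Submodule.iInf_orthogonal, Submodule.mem_iInf]
    intro μ u hu
    have hu' : B u = μ • u := Module.End.mem_eigenspace_iff.1 hu
    have hsym : inner ℂ u (B g) = inner ℂ (B u) g := (hBs u g).symm
    rw [hsym, hu']
    by_cases hμ : μ = 0
    · simp [hμ]
    · rw [inner_smul_left]
      have : inner ℂ u g = 0 := by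
        refine hgN (Module.End.eigenspace (B : H →ₗ[ℂ] H) μ)
          (ContinuousLinearMap.finite_dimensional_eigenspace hBc μ hμ) ?_ ?_ ?_ u hu
        · intro x hx
          have hx' : B x = μ • x := Module.End.mem_eigenspace_iff.1 hx
          have : x = μ⁻¹ • B x := by rw [hx', inv_smul_smul₀ hμ]
          rw [this]
          exact M.smul_mem _ (hPM _)
        · intro x hx
          have hx' : B x = μ • x := Module.End.mem_eigenspace_iff.1 hx
          rw [Module.End.mem_eigenspace_iff]
          change B (T x) = μ • T x
          rw [hB, hPT, hQT, hPT, ← hB, hx', map_smul]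
        · intro x hx
          have hx' : B x = μ • x := Module.End.mem_eigenspace_iff.1 hx
          rw [Module.End.mem_eigenspace_iff]
          change B (ContinuousLinearMap.adjoint T x) = μ • ContinuousLinearMap.adjoint T x
          rw [hB, hPT', hQT', hPT', ← hB, hx', map_smul]
      rw [this, mul_zero]
  have h1 : inner ℂ (Q g) (Q g) = 0 := by
    have h2 : inner ℂ (Q g) (Q g) = inner ℂ g (Q (Q g)) := hQ g (Q g)
    have h3 : Q (Q g) = Q g := congrArg (fun L : H →L[ℂ] H => L g) hQQ
    rw [h2, h3]
    have h4 : inner ℂ (P g) (Q g) = inner ℂ g (P (Q g)) := hP g (Q g)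
    rw [hg] at h4
    rw [h4]
    have h5 : P (Q g) = B g := by rw [hB, hg]
    rw [h5, hBg, inner_zero_right]
  exact inner_self_eq_zero.1 h1

lemma aux_data {H : Type*} [NormedAddCommGroup H] [InnerProductSpace ℂ H] [CompleteSpace H]
    (U T : H →L[ℂ] H) (hU : ∀ x y, inner ℂ (U x) (U y) = inner ℂ x y)
    (hU' : ¬ Function.Surjective U) (a : ℝ) (ha : 0 < a)
    (h : CompalentToReducingPart ((a : ℂ) • U) T) :
    ∃ (M : Submodule ℂ H) (P V : H →L[ℂ] H) (g : H),
      (∀ x, P x ∈ M) ∧ P.IsSymmetric ∧ P * P = P ∧ (∀ x, P (T x) = T (P x)) ∧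
      (∀ x, P (ContinuousLinearMap.adjoint T x) = ContinuousLinearMap.adjoint T (P x)) ∧
      P * V = V ∧ ‖V‖ ≤ 1 ∧ ContinuousLinearMap.adjoint V * V = P ∧
      IsCompactOperator (T * P - (a : ℂ) • V) ∧ P g = g ∧ g ≠ 0 ∧
      (∀ N : Submodule ℂ H, FiniteDimensional ℂ N → N ≤ M → (∀ x ∈ N, T x ∈ N) →
      (∀ x ∈ N, ContinuousLinearMap.adjoint T x ∈ N) → g ∈ Nᗮ) := by
  obtain ⟨M, hMc, hT, hT', W, hW⟩ := h
  have : CompleteSpace M := hMc.completeSpace_coe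
  let R : M →L[ℂ] M := conjOp W U
  have hRx : ∀ x, R x = W (U (W.symm x)) := fun x => rfl
  have hRa : conjOp W ((a : ℂ) • U) = (a : ℂ) • R := by
    ext x
    simp [conjOp, R]
  rw [hRa] at hW
  have hRi : ∀ x y, inner ℂ (R x) (R y) = inner ℂ x y := by
    intro x y
    rw [hRx, hRx, W.inner_map_map, hU, W.symm.inner_map_map]
  have hRn : ∀ x, ‖R x‖ = ‖x‖ := by
    intro x
    rw [@norm_eq_sqrt_re_inner ℂ, @norm_eq_sqrt_re_inner ℂ _ _ _ _ x, hRi]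
  have hRs : ¬ Function.Surjective R := by
    intro hs
    apply hU'
    intro y
    obtain ⟨x, hx⟩ := hs (W y)
    exact ⟨W.symm x, W.injective (by rw [← hRx, hx])⟩
  let P : H →L[ℂ] H := M.starProjection
  let p : H →L[ℂ] M := M.orthogonalProjectionOnto
  have hp : ∀ x, (p x : H) = P x := fun x => rfl
  let V : H →L[ℂ] H := M.subtypeL.comp (R.comp p)
  have hVx : ∀ x, V x = (R (p x) : H) := fun x => rfl
  obtain ⟨g, hg0, hg⟩ := aux_main (opRestrict T M hT) ((a : ℂ) • R) a ha
    (by intro x; simp [norm_smul, hRn, abs_of_pos ha])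
    (by
      intro hs
      apply hRs
      intro y
      obtain ⟨x, hx⟩ := hs ((a : ℂ) • y)
      refine ⟨x, smul_right_injective _ (r := (a : ℂ)) (by exact_mod_cast ha.ne') ?_⟩
      simpa using hx) hW
  have hPs : P.IsSymmetric := M.starProjection_isSymmetric
  have hPP : P * P = P := M.isIdempotentElem_starProjection
  refine ⟨M, P, V, g, M.starProjection_apply_mem, hPs, hPP, aux_comm T M hT hT', 
    aux_comm _ M hT' (by simpa using hT), ?_, ?_, ?_, ?_, ?_, by simpa using hg0, ?_⟩
  · ext x
    exact M.starProjection_eq_self_iff.2 (R (p x)).2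
  · refine ContinuousLinearMap.opNorm_le_bound _ zero_le_one fun x => ?_
    rw [hVx, ← Submodule.coe_norm, hRn, one_mul]
    exact M.norm_orthogonalProjectionOnto_apply_le x
  · ext x
    refine ext_inner_left ℂ fun y => ?_
    change inner ℂ y (ContinuousLinearMap.adjoint V (V x)) = _
    rw [ContinuousLinearMap.adjoint_inner_right, hVx, hVx, ← Submodule.coe_inner, hRi,
      Submodule.coe_inner, hp, hp]
    have h1 : inner ℂ (P y) (P x) = inner ℂ y (P (P x)) := hPs y (P x)
    have h2 : P (P x) = P x := congrArg (fun L : H →L[ℂ] H => L x) hPP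
    rw [h1, h2]
  · have h1 := (hW.comp_clm p).clm_comp M.subtypeL
    exact h1
  · exact M.starProjection_eq_self_iff.2 g.2
  · intro N hNf hNM hN hN' u hu
    have hR : AuxR (opRestrict T M hT) (N.comap M.subtype) := by
      refine ⟨?_, fun x hx => hN _ hx, ?_⟩
      · exact FiniteDimensional.of_injective (M.subtype.restrict (q := N) (fun x hx => hx))
          (fun x y hxy => Subtype.ext (Subtype.ext (congrArg (fun z : N => (z : H)) hxy)))
      · intro x hx v hv
        have h1 : inner ℂ (v : H) (T x) = 0 := by
          rw [← ContinuousLinearMap.adjoint_inner_left]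
          exact hx ⟨ContinuousLinearMap.adjoint T v, hT' _ v.2⟩ (hN' _ hv)
        exact h1
    exact hg _ hR ⟨u, hNM hu⟩ hu

lemma aux_sep {H : Type*} [NormedAddCommGroup H] [InnerProductSpace ℂ H]
    [TopologicalSpace.SeparableSpace H] {ι : Type*} (g : ι → H) (hg : ∀ i, g i ≠ 0)
    (ho : ∀ i j, i ≠ j → inner ℂ (g i) (g j) = 0) : Countable ι := by
  let f : ι → H := fun i => ((‖g i‖⁻¹ : ℝ) : ℂ) • g i
  have hf : ∀ i, ‖f i‖ = 1 := by
    intro i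
    have := norm_pos_iff.2 (hg i)
    simp [f, norm_smul, this.ne']
  refine Pairwise.countable_of_isOpen_disjoint (s := fun i => Metric.ball (f i) (1/2)) ?_
    (fun i => Metric.isOpen_ball) (fun i => ⟨f i, Metric.mem_ball_self (by norm_num)⟩)
  intro i j hij
  apply Metric.ball_disjoint_ball
  have h1 : inner ℂ (f i) (f j) = 0 := by
    simp [f, ho i j hij]
  have h2 := norm_sub_sq (𝕜 := ℂ) (f i) (f j)
  rw [h1, hf, hf] at h2
  simp at h2
  rw [dist_eq_norm]
  nlinarith [norm_nonneg (f i - f j)]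

/-- **Corollary 2.7.** Let `U` be the unilateral shift of multiplicity one, i.e. the
operator sending the `n`-th vector of an orthonormal basis indexed by `ℕ` to the `(n+1)`-st one.
There is no operator `T` such that every `α • U`, `α ∈ [0,1]`, is compalent to a reducing part
of `T`. -/
theorem stmt8 {H : Type*} [NormedAddCommGroup H] [InnerProductSpace ℂ H] [CompleteSpace H]
    [TopologicalSpace.SeparableSpace H] (hinf : ¬ FiniteDimensional ℂ H)
    (e : HilbertBasis ℕ ℂ H) (U : H →L[ℂ] H) (hU : ∀ n : ℕ, U (e n) = e (n + 1)) :
    ¬ ∃ T : H →L[ℂ] H, ∀ α ∈ Set.Icc (0 : ℝ) 1,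
      CompalentToReducingPart ((α : ℂ) • U) T := by
  rintro ⟨T, hT⟩
  obtain ⟨hU1, hU2⟩ := aux_U e U hU
  have key := fun a : Set.Ioc (0 : ℝ) 1 =>
    aux_data U T hU1 hU2 a.1 a.2.1 (hT a.1 ⟨a.2.1.le, a.2.2⟩)
  choose M P V g h1 h2 h3 h4 h5 h6 h7 h8 h9 h10 h11 h12 using key
  have hlt : ∀ a b : Set.Ioc (0 : ℝ) 1, a.1 < b.1 → inner ℂ (g a) (g b) = 0 := by
    intro a b hab
    have hc := aux_pair T (P a) (P b) (V a) (V b) a.1 b.1 a.2.1.le hab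
      (ContinuousLinearMap.ext (h4 b)) (h6 a) (h7 a) (h7 b) (h8 b) (h9 a) (h9 b)
    have h0 := aux_orth T (P a) (P b) (M a) (h1 a) (h2 a) (h2 b) (h3 b) (h4 a) (h4 b) (h5 a) (h5 b)
      hc (g a) (h10 a) (h12 a)
    have hs : inner ℂ (P b (g a)) (g b) = inner ℂ (g a) (P b (g b)) := h2 b (g a) (g b)
    rw [h0, h10, inner_zero_left] at hs
    exact hs.symm
  have hcount : Countable (Set.Ioc (0 : ℝ) 1) := by
    refine aux_sep g h11 fun a b hab => ?_
    rcases lt_or_gt_of_ne (fun h => hab (Subtype.ext h) : a.1 ≠ b.1) with h | h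
    · exact hlt a b h
    · exact inner_eq_zero_symm.1 (hlt b a h)
  exact absurd (Set.countable_coe_iff.1 hcount) (by simp [Cardinal.Real.Ioc_countable_iff])
end

section
/- Let H be a separable infinite-dimensional complex Hilbert space. There is no bounded operator T on H such that every contraction on H is compalent to a reducing part of T. -/
open Filter Topology ContinuousLinearMap

section Helpers

variable {H : Type*} [NormedAddCommGroup H] [InnerProductSpace ℂ H] [CompleteSpace H]

theorem hp_compact_adjoint (K : H →L[ℂ] H) (hK : IsCompactOperator K) :
    IsCompactOperator (ContinuousLinearMap.adjoint K) := by
  have hC : IsCompactOperator (K ∘L ContinuousLinearMap.adjoint K) := hK.comp_clm _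
  rw [isCompactOperator_iff_exists_mem_nhds_isCompact_closure_image]
  refine ⟨Metric.ball 0 1, Metric.ball_mem_nhds _ one_pos, ?_⟩
  have hcc := hC.isCompact_closure_image_ball 1
  have htb := hcc.totallyBounded.subset subset_closure
  refine TotallyBounded.isCompact_of_isClosed ?_ isClosed_closure
  refine TotallyBounded.closure ?_
  rw [Metric.totallyBounded_iff]
  intro ε hε
  obtain ⟨t, hts, htf, htc⟩ := totallyBounded_iff_subset.mp htb _
    (Metric.dist_mem_uniformity (show 0 < ε ^ 2 / 2 by positivity))
  have hts' : ∀ y ∈ t, ∃ x : H, x ∈ Metric.ball (0 : H) 1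
      ∧ K (ContinuousLinearMap.adjoint K x) = y := fun y hy => hts hy
  choose! g hg using hts'
  refine ⟨(fun y => ContinuousLinearMap.adjoint K (g y)) '' t, htf.image _, ?_⟩
  rintro _ ⟨x, hx, rfl⟩
  have h1 := htc ⟨x, hx, rfl⟩
  simp only [Set.mem_iUnion, Set.mem_ofPred_eq, exists_prop] at h1
  obtain ⟨y, hy, hxy⟩ := h1
  obtain ⟨hgb, hgy⟩ := hg y hy
  simp only [Set.mem_iUnion, exists_prop]
  refine ⟨_, ⟨y, hy, rfl⟩, ?_⟩
  rw [Metric.mem_ball]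
  rw [← hgy, dist_eq_norm] at hxy
  have hxy2 : ‖K (ContinuousLinearMap.adjoint K x) - K (ContinuousLinearMap.adjoint K (g y))‖
    < ε ^ 2 / 2 := hxy
  rw [← map_sub, ← map_sub] at hxy2
  rw [dist_eq_norm]
  change ‖ContinuousLinearMap.adjoint K x - ContinuousLinearMap.adjoint K (g y)‖ < ε
  rw [← map_sub]
  set z := x - g y with hz
  have hzn : ‖z‖ ≤ 2 := by
    have h2 := norm_sub_le x (g y)
    simp only [Metric.mem_ball, dist_zero_right] at hx hgb
    linarith
  have h3 : ‖ContinuousLinearMap.adjoint K z‖ ^ 2 ≤ ‖K (ContinuousLinearMap.adjoint K z)‖ * ‖z‖ := by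
    have h4 : inner ℂ (K (ContinuousLinearMap.adjoint K z)) z
        = ((‖ContinuousLinearMap.adjoint K z‖ : ℂ)) ^ 2 := by
      rw [← ContinuousLinearMap.adjoint_inner_right, inner_self_eq_norm_sq_to_K]
      rfl
    have h5 := norm_inner_le_norm (𝕜 := ℂ) (K (ContinuousLinearMap.adjoint K z)) z
    rw [h4] at h5
    simpa using h5
  have hxy' : ‖K (ContinuousLinearMap.adjoint K z)‖ < ε ^ 2 / 2 := hxy2
  have h6 : ‖ContinuousLinearMap.adjoint K z‖ ^ 2 < ε ^ 2 := by
    nlinarith [norm_nonneg (K (ContinuousLinearMap.adjoint K z)), norm_nonneg z]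
  exact lt_of_pow_lt_pow_left₀ 2 hε.le h6

theorem hp_ev_small (K : H →L[ℂ] H) (hK : IsCompactOperator K) (F : ℕ → Submodule ℂ H)
    (hF : ∀ m n, m < n → F m ⟂ F n) (ε : ℝ) (hε : 0 < ε) :
    ∀ᶠ n in atTop, ∀ f ∈ F n, ‖K f‖ ≤ ε * ‖f‖ := by
  by_contra hcon
  rw [Filter.not_eventually] at hcon
  obtain ⟨φ, hφ, hφ'⟩ := Filter.extraction_of_frequently_atTop
    (P := fun n => ¬ ∀ f ∈ F n, ‖K f‖ ≤ ε * ‖f‖) hcon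
  have h1 : ∀ n, ∃ f ∈ F (φ n), ‖f‖ = 1 ∧ ε < ‖K f‖ := by
    intro n
    have := hφ' n
    push Not at this
    obtain ⟨f, hf, hlt⟩ := this
    have hf0 : f ≠ 0 := by
      rintro rfl
      simp at hlt
    have hn : 0 < ‖f‖ := norm_pos_iff.mpr hf0
    refine ⟨((‖f‖⁻¹ : ℝ) : ℂ) • f, Submodule.smul_mem _ _ hf, ?_, ?_⟩
    · rw [norm_smul]; simp [hn.ne']
    · rw [map_smul, norm_smul]
      simp only [Complex.norm_real, norm_inv, norm_norm]
      rw [inv_mul_eq_div, lt_div_iff₀ hn]; exact hlt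
  choose f hfF hf1 hfK using h1
  have hon : Orthonormal ℂ f := by
    refine ⟨hf1, ?_⟩
    intro i j hij
    rcases lt_or_gt_of_ne hij with h | h
    · exact (hF _ _ (hφ h)).inner_eq (hfF i) (hfF j)
    · exact (hF _ _ (hφ h)).symm.inner_eq (hfF i) (hfF j)
  have hcc := hK.isCompact_closure_image_closedBall 1
  obtain ⟨y, -, ψ, hψ, hlim⟩ := hcc.tendsto_subseq (x := fun n => K (f n))
    (fun n => subset_closure ⟨f n, by simp [hf1 n], rfl⟩)
  have hz : Tendsto (fun n => inner ℂ (f n) (ContinuousLinearMap.adjoint K y)) atTop (𝓝 0) := by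
    have hs := hon.inner_products_summable (ContinuousLinearMap.adjoint K y)
    have h0 := hs.tendsto_atTop_zero
    rw [tendsto_zero_iff_norm_tendsto_zero]
    have := h0.sqrt
    simpa [Real.sqrt_sq] using this
  have hz2 := hz.comp hψ.tendsto_atTop
  have hz3 : Tendsto (fun n => inner ℂ (K (f (ψ n))) y) atTop (𝓝 (inner ℂ y y)) :=
    Filter.Tendsto.inner hlim tendsto_const_nhds
  have hy : inner ℂ y y = 0 := by
    refine tendsto_nhds_unique hz3 ?_
    refine hz2.congr fun n => ?_
    simp [ContinuousLinearMap.adjoint_inner_right]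
  have hy0 : y = 0 := inner_self_eq_zero.mp hy
  have := hlim.norm
  rw [hy0, norm_zero] at this
  have h2 : ε ≤ 0 := ge_of_tendsto' this (fun n => (hfK (ψ n)).le)
  linarith

/-- reducing subspace -/
def HpRed (T : H →L[ℂ] H) (M : Submodule ℂ H) : Prop :=
  (∀ x ∈ M, T x ∈ M) ∧ (∀ x ∈ M, ContinuousLinearMap.adjoint T x ∈ M)

theorem HpRed.orth {T : H →L[ℂ] H} {M : Submodule ℂ H} (h : HpRed T M) : HpRed T Mᗮ := by
  constructor
  · intro x hx
    rw [Submodule.mem_orthogonal] at hx ⊢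
    intro u hu
    rw [← ContinuousLinearMap.adjoint_inner_left]
    exact hx _ (h.2 u hu)
  · intro x hx
    rw [Submodule.mem_orthogonal] at hx ⊢
    intro u hu
    rw [ContinuousLinearMap.adjoint_inner_right]
    exact hx _ (h.1 u hu)

theorem HpRed.inf {T : H →L[ℂ] H} {M N : Submodule ℂ H} (h : HpRed T M) (h' : HpRed T N) :
    HpRed T (M ⊓ N) :=
  ⟨fun x hx => ⟨h.1 x hx.1, h'.1 x hx.2⟩, fun x hx => ⟨h.2 x hx.1, h'.2 x hx.2⟩⟩

theorem HpRed.sup {T : H →L[ℂ] H} {M N : Submodule ℂ H} (h : HpRed T M) (h' : HpRed T N) :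
    HpRed T (M ⊔ N) := by
  constructor
  · intro x hx
    obtain ⟨y, hy, z, hz, rfl⟩ := Submodule.mem_sup.mp hx
    rw [map_add]
    exact Submodule.add_mem_sup (h.1 y hy) (h'.1 z hz)
  · intro x hx
    obtain ⟨y, hy, z, hz, rfl⟩ := Submodule.mem_sup.mp hx
    rw [map_add]
    exact Submodule.add_mem_sup (h.2 y hy) (h'.2 z hz)

theorem HpRed.adj {T : H →L[ℂ] H} {M : Submodule ℂ H} (h : HpRed T M) :
    HpRed (ContinuousLinearMap.adjoint T) M := by
  refine ⟨h.2, ?_⟩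
  rw [ContinuousLinearMap.adjoint_adjoint]
  exact h.1

theorem HpRed.commute {T : H →L[ℂ] H} {M : Submodule ℂ H} [M.HasOrthogonalProjection]
    (h : HpRed T M) (x : H) : M.starProjection (T x) = T (M.starProjection x) := by
  apply Submodule.eq_starProjection_of_mem_orthogonal
  · exact h.1 _ (Submodule.starProjection_apply_mem _ _)
  · rw [← map_sub]
    exact h.orth.1 _ (Submodule.sub_starProjection_mem_orthogonal x)

/-- the key finite-dimensional obstruction -/
theorem hp_key (T D : H →L[ℂ] H) (a τ ε : ℝ) (ha : 0 < a) (ha2 : a ≤ 1 / 2)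
    (hD : ∀ x, D x = ContinuousLinearMap.adjoint T (T x) - (1 / 4 : ℂ) • x)
    (hτ : ∀ x, ‖T x‖ ≤ τ * ‖x‖) (hτ0 : 0 ≤ τ)
    (hε : 0 < ε) (h1 : ε * (a ^ 2 + τ ^ 2) ≤ a ^ 4 / 8) (h2 : 3 * ε * τ ≤ a ^ 6 / 4)
    (h3 : ε ≤ a ^ 4 / 8)
    (F : Submodule ℂ H) [FiniteDimensional ℂ F] (hF : HpRed T F) (hF0 : F ≠ ⊥)
    (r1 : ∀ f ∈ F, ‖ContinuousLinearMap.adjoint T (D (T f)) - ((a ^ 2 / 4 : ℝ) : ℂ) • f‖ ≤ ε * ‖f‖)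
    (r2 : ∀ f ∈ F, ‖D (D f) - ((a ^ 2 : ℝ) : ℂ) • D f‖ ≤ ε * ‖f‖) : False := by
  have hDF : ∀ f ∈ F, D f ∈ F := by
    intro f hf
    rw [hD]
    exact F.sub_mem (hF.2 _ (hF.1 _ hf)) (F.smul_mem _ hf)
  have hDs : ∀ x y, inner ℂ (D x) y = inner ℂ x (D y) := by
    intro x y
    rw [hD, hD]
    simp only [inner_sub_left, inner_sub_right, inner_smul_left, inner_smul_right,
      ContinuousLinearMap.adjoint_inner_left, ContinuousLinearMap.adjoint_inner_right]
    simp [map_ofNat]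
  -- Re<DTf,Tf> close to a²/4
  have e1 : ∀ f ∈ F, |RCLike.re (inner ℂ (D (T f)) (T f)) - a ^ 2 / 4 * ‖f‖ ^ 2| ≤ ε * ‖f‖ ^ 2 := by
    intro f hf
    have hh : RCLike.re (inner ℂ (D (T f)) (T f)) - a ^ 2 / 4 * ‖f‖ ^ 2
        = RCLike.re (inner ℂ (ContinuousLinearMap.adjoint T (D (T f))
            - ((a ^ 2 / 4 : ℝ) : ℂ) • f) f) := by
      rw [inner_sub_left, ContinuousLinearMap.adjoint_inner_left, inner_smul_left, map_sub,
        Complex.conj_ofReal, inner_self_eq_norm_sq_to_K]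
      congr 1
      simp [← Complex.ofReal_pow]
    rw [hh]
    calc _ ≤ ‖inner ℂ (ContinuousLinearMap.adjoint T (D (T f))
            - ((a ^ 2 / 4 : ℝ) : ℂ) • f) f‖ := RCLike.abs_re_le_norm _
      _ ≤ _ := norm_inner_le_norm _ _
      _ ≤ (ε * ‖f‖) * ‖f‖ := by gcongr; exact r1 f hf
      _ = _ := by ring
  have e2 : ∀ f ∈ F, |‖D f‖ ^ 2 - a ^ 2 * RCLike.re (inner ℂ (D f) f)| ≤ ε * ‖f‖ ^ 2 := by
    intro f hf
    have hh : ‖D f‖ ^ 2 - a ^ 2 * RCLike.re (inner ℂ (D f) f)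
        = RCLike.re (inner ℂ (D (D f) - ((a ^ 2 : ℝ) : ℂ) • D f) f) := by
      rw [inner_sub_left, hDs (D f), inner_smul_left, map_sub,
        Complex.conj_ofReal, inner_self_eq_norm_sq_to_K]
      congr 1
      · norm_cast
      · simp [← Complex.ofReal_pow]
    rw [hh]
    calc _ ≤ ‖inner ℂ (D (D f) - ((a ^ 2 : ℝ) : ℂ) • D f) f‖ := RCLike.abs_re_le_norm _
      _ ≤ _ := norm_inner_le_norm _ _
      _ ≤ (ε * ‖f‖) * ‖f‖ := by gcongr; exact r2 f hf
      _ = _ := by ring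
  have e3 : ∀ f ∈ F, a ^ 4 / 8 * ‖f‖ ^ 2 ≤ ‖D (T f)‖ ^ 2 := by
    intro f hf
    have h4 := (abs_le.mp (e2 (T f) (hF.1 f hf))).1
    have h5 := (abs_le.mp (e1 f hf)).1
    have h6 : ‖T f‖ ^ 2 ≤ τ ^ 2 * ‖f‖ ^ 2 := by
      rw [← mul_pow]; gcongr; exact hτ f
    have h7 : ε * ‖T f‖ ^ 2 ≤ ε * (τ ^ 2 * ‖f‖ ^ 2) := by gcongr
    have h8 : a ^ 2 * (a ^ 2 / 4 * ‖f‖ ^ 2 - ε * ‖f‖ ^ 2)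
      ≤ a ^ 2 * RCLike.re (inner ℂ (D (T f)) (T f)) := by gcongr; linarith
    have h9 : ε * (a ^ 2 + τ ^ 2) * ‖f‖ ^ 2 ≤ a ^ 4 / 8 * ‖f‖ ^ 2 := by gcongr
    nlinarith
  have e4 : ∀ f ∈ F, a ^ 2 * ‖f‖ ≤ 3 * ‖D (T f)‖ := by
    intro f hf
    have := e3 f hf
    have h9 : (a ^ 2 * ‖f‖) ^ 2 ≤ (3 * ‖D (T f)‖) ^ 2 := by
      rw [mul_pow, mul_pow, ← pow_mul]; norm_num; nlinarith [sq_nonneg ‖D (T f)‖]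
    exact le_of_sq_le_sq h9 (by positivity)
  -- surjectivity
  have hsurj : ∀ g ∈ F, ∃ f ∈ F, D (T f) = g := by
    let B : F →ₗ[ℂ] F := ((D ∘L T : H →L[ℂ] H) : H →ₗ[ℂ] H).restrict
      (p := F) (q := F) (fun x hx => hDF _ (hF.1 _ hx))
    have hB : Function.Injective B := by
      rw [← LinearMap.ker_eq_bot, LinearMap.ker_eq_bot']
      intro m hm
      have h5 : D (T m) = 0 := congrArg Subtype.val hm
      have h6 := e3 m m.2
      rw [h5] at h6
      have : ‖(m : H)‖ ^ 2 ≤ 0 := by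
        by_contra hc
        push Not at hc
        have : 0 < a ^ 4 / 8 * ‖(m : H)‖ ^ 2 := by positivity
        simp at h6
        linarith
      have h7 : ‖(m : H)‖ = 0 := by nlinarith [norm_nonneg (m : H)]
      exact Subtype.ext (norm_eq_zero.mp h7)
    have hB' := LinearMap.surjective_of_injective hB
    intro g hg
    obtain ⟨f, hf⟩ := hB' ⟨g, hg⟩
    exact ⟨f, f.2, congrArg Subtype.val hf⟩
  have e5 : ∀ g ∈ F, ‖D g - ((a ^ 2 : ℝ) : ℂ) • g‖ ≤ a ^ 4 / 4 * ‖g‖ := by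
    intro g hg
    obtain ⟨f, hf, rfl⟩ := hsurj g hg
    have h4 := r2 (T f) (hF.1 f hf)
    have h5 := e4 f hf
    have h6 : ε * ‖T f‖ ≤ ε * (τ * ‖f‖) := by gcongr; exact hτ f
    refine h4.trans (h6.trans ?_)
    have h7 : ε * τ * (a ^ 2 * ‖f‖) ≤ ε * τ * (3 * ‖D (T f)‖) := by gcongr
    have h8 : 3 * ε * τ * ‖D (T f)‖ ≤ a ^ 6 / 4 * ‖D (T f)‖ := by gcongr
    have h9 : a ^ 2 * (ε * (τ * ‖f‖)) ≤ a ^ 2 * (a ^ 4 / 4 * ‖D (T f)‖) := by nlinarith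
    exact le_of_mul_le_mul_left h9 (by positivity)
  have e6 : ∀ g ∈ F, (a ^ 2 - a ^ 4 / 4) * ‖g‖ ^ 2 ≤ RCLike.re (inner ℂ (D g) g) := by
    intro g hg
    have hh : RCLike.re (inner ℂ (D g) g) - a ^ 2 * ‖g‖ ^ 2
        = RCLike.re (inner ℂ (D g - ((a ^ 2 : ℝ) : ℂ) • g) g) := by
      rw [inner_sub_left, inner_smul_left, map_sub,
        Complex.conj_ofReal, inner_self_eq_norm_sq_to_K]
      congr 1
      simp [← Complex.ofReal_pow]
    have h4 : |RCLike.re (inner ℂ (D g - ((a ^ 2 : ℝ) : ℂ) • g) g)| ≤ a ^ 4 / 4 * ‖g‖ ^ 2 := by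
      calc _ ≤ ‖inner ℂ (D g - ((a ^ 2 : ℝ) : ℂ) • g) g‖ := RCLike.abs_re_le_norm _
        _ ≤ _ := norm_inner_le_norm _ _
        _ ≤ (a ^ 4 / 4 * ‖g‖) * ‖g‖ := by gcongr; exact e5 g hg
        _ = _ := by ring
    rw [← hh] at h4
    have := (abs_le.mp h4).1
    linarith
  obtain ⟨f, hf, hf0⟩ := Submodule.exists_mem_ne_zero_of_ne_bot hF0
  have hn : 0 < ‖f‖ ^ 2 := by have := norm_pos_iff.mpr hf0; positivity
  have t1 : ‖T f‖ ^ 2 = RCLike.re (inner ℂ (D f) f) + 1 / 4 * ‖f‖ ^ 2 := by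
    rw [hD, inner_sub_left, inner_smul_left, ContinuousLinearMap.adjoint_inner_left, map_sub,
      inner_self_eq_norm_sq_to_K, inner_self_eq_norm_sq_to_K]
    simp [← Complex.ofReal_pow]
  have t2 := e6 f hf
  have t3 := e6 (T f) (hF.1 f hf)
  have t4 := (abs_le.mp (e1 f hf)).2
  have ha4 : a ^ 2 ≤ 1 / 4 := by nlinarith
  have t5 : 0 ≤ a ^ 2 - a ^ 4 / 4 := by nlinarith [sq_nonneg a]
  have t6 : (a ^ 2 - a ^ 4 / 4) * ((a ^ 2 - a ^ 4 / 4) * ‖f‖ ^ 2 + 1 / 4 * ‖f‖ ^ 2)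
     ≤ (a ^ 2 - a ^ 4 / 4) * ‖T f‖ ^ 2 := by
    gcongr; linarith
  have t7 : ((a ^ 2 - a ^ 4 / 4) * ((a ^ 2 - a ^ 4 / 4) + 1 / 4)) * ‖f‖ ^ 2 ≤ (a ^ 2 / 4 + ε) * ‖f‖ ^ 2 := by
    linarith
  have t8 := le_of_mul_le_mul_right t7 hn
  have ha0 : 0 < a ^ 4 := by positivity
  have t9 : a ^ 4 / 4 ≤ a ^ 2 / 16 := by nlinarith [sq_nonneg a]
  have t10 : (15 / 16 * a ^ 2) ^ 2 ≤ (a ^ 2 - a ^ 4 / 4) ^ 2 := by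
    apply pow_le_pow_left₀ (by positivity); linarith
  nlinarith



/-- no nonzero finite-dimensional reducing subspace -/
def HpNF (T : H →L[ℂ] H) (M : Submodule ℂ H) : Prop :=
  ∀ F : Submodule ℂ H, F ≤ M → HpRed T F → FiniteDimensional ℂ F → F = ⊥

theorem hp_trim (T D : H →L[ℂ] H) (a : ℝ) (ha : 0 < a) (ha2 : a ≤ 1 / 2)
    (hD : ∀ x, D x = ContinuousLinearMap.adjoint T (T x) - (1 / 4 : ℂ) • x)
    (M : Submodule ℂ H) (hMc : IsClosed (M : Set H)) (hM : HpRed T M)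
    (hMi : ¬ FiniteDimensional ℂ M)
    (K1 K2 : H →L[ℂ] H) (hK1 : IsCompactOperator K1) (hK2 : IsCompactOperator K2)
    (h1 : ∀ f ∈ M, K1 f = ContinuousLinearMap.adjoint T (D (T f)) - ((a ^ 2 / 4 : ℝ) : ℂ) • f)
    (h2 : ∀ f ∈ M, K2 f = D (D f) - ((a ^ 2 : ℝ) : ℂ) • D f) :
    ∃ M' : Submodule ℂ H, M' ≤ M ∧ IsClosed (M' : Set H) ∧ HpRed T M' ∧ HpNF T M' ∧ M' ≠ ⊥ := by
  have hs : ∃ G : Submodule ℂ H, FiniteDimensional ℂ G ∧ HpRed T G ∧ HpNF T (M ⊓ Gᗮ) := by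
    by_contra hcon
    push Not at hcon
    have := exists_seq_of_forall_finset_exists
      (fun F : Submodule ℂ H => F ≤ M ∧ HpRed T F ∧ FiniteDimensional ℂ F ∧ F ≠ ⊥)
      (fun F F' => F ⟂ F') (by
        classical
        intro s hs
        have hG : FiniteDimensional ℂ (s.sup id : Submodule ℂ H) ∧ HpRed T (s.sup id) := by
          induction s using Finset.induction_on with
          | empty =>
            refine ⟨inferInstanceAs (FiniteDimensional ℂ (⊥ : Submodule ℂ H)), ?_⟩
            simp [HpRed]
          | insert x s hx ih =>
            obtain ⟨i1, i2⟩ := ih (fun y hy => hs y (Finset.mem_insert_of_mem hy))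
            obtain ⟨j1, j2, j3, j4⟩ := hs x (Finset.mem_insert_self _ _)
            rw [Finset.sup_insert, id]
            exact ⟨inferInstance, j2.sup i2⟩
        have h3 := hcon _ hG.1 hG.2
        unfold HpNF at h3
        push Not at h3
        obtain ⟨F, hF1, hF2, hF3, hF4⟩ := h3
        refine ⟨F, ⟨hF1.trans inf_le_left, hF2, hF3, hF4⟩, ?_⟩
        intro x hx
        rw [Submodule.isOrtho_comm]
        refine (hF1.trans inf_le_right).trans (Submodule.orthogonal_le ?_)
        exact Finset.le_sup (f := id) hx)
    obtain ⟨F, hF, hort⟩ := this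
    set τ := ‖T‖ with hτ
    have hτ0 : 0 ≤ τ := norm_nonneg _
    obtain ⟨ε, hε, e1, e2, e3⟩ : ∃ ε : ℝ, 0 < ε ∧ ε * (a ^ 2 + τ ^ 2) ≤ a ^ 4 / 8 ∧
        3 * ε * τ ≤ a ^ 6 / 4 ∧ ε ≤ a ^ 4 / 8 := by
      refine ⟨min (a ^ 4 / 8 / (a ^ 2 + τ ^ 2)) (min (a ^ 6 / 4 / (3 * (τ + 1))) (a ^ 4 / 8)),
        by positivity, ?_, ?_, ?_⟩
      · rw [← le_div_iff₀ (by positivity)]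
        exact min_le_left _ _
      · set e := min (a ^ 4 / 8 / (a ^ 2 + τ ^ 2)) (min (a ^ 6 / 4 / (3 * (τ + 1))) (a ^ 4 / 8))
        have he : 0 < e := by positivity
        have : e ≤ a ^ 6 / 4 / (3 * (τ + 1)) := (min_le_right _ _).trans (min_le_left _ _)
        rw [le_div_iff₀ (by positivity)] at this
        nlinarith
      · exact (min_le_right _ _).trans (min_le_right _ _)
    obtain ⟨n, hn1, hn2⟩ := ((hp_ev_small K1 hK1 F hort ε hε).and
      (hp_ev_small K2 hK2 F hort ε hε)).exists
    obtain ⟨g1, g2, g3, g4⟩ := hF n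
    exact hp_key T D a τ ε ha ha2 hD (fun x => T.le_opNorm x) hτ0 hε e1 e2 e3 (F n) g2 g4
      (fun f hf => by rw [← h1 f (g1 hf)]; exact hn1 f hf)
      (fun f hf => by rw [← h2 f (g1 hf)]; exact hn2 f hf)
  obtain ⟨G, hG1, hG2, hG3⟩ := hs
  refine ⟨M ⊓ Gᗮ, inf_le_left, hMc.inter (Submodule.isClosed_orthogonal G), hM.inf hG2.orth,
    hG3, ?_⟩
  intro hbot
  apply hMi
  have hinj : Function.Injective ((G.orthogonalProjectionOnto : H →ₗ[ℂ] G) ∘ₗ M.subtype) := by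
    rw [← LinearMap.ker_eq_bot, LinearMap.ker_eq_bot']
    intro m hm
    have h4 : G.orthogonalProjectionOnto (m : H) = 0 := hm
    rw [Submodule.orthogonalProjectionOnto_eq_zero_iff] at h4
    have : (m : H) ∈ M ⊓ Gᗮ := ⟨m.2, h4⟩
    rw [hbot, Submodule.mem_bot] at this
    exact Subtype.ext this
  exact FiniteDimensional.of_injective _ hinj

theorem hp_orth (T : H →L[ℂ] H) (M N : Submodule ℂ H) [M.HasOrthogonalProjection]
    [N.HasOrthogonalProjection] (hM : HpRed T M) (hN : HpRed T N) (hMf : HpNF T M)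
    (hc : IsCompactOperator (N.starProjection ∘L M.starProjection)) : M ⟂ N := by
  set Y : H →L[ℂ] H := M.starProjection ∘L (N.starProjection ∘L M.starProjection) with hY
  have hYc : IsCompactOperator Y := hc.clm_comp M.starProjection
  have hYs : (Y : H →ₗ[ℂ] H).IsSymmetric := by
    intro x y
    simp only [hY, ContinuousLinearMap.coe_coe, ContinuousLinearMap.comp_apply,
      Submodule.inner_starProjection_left_eq_right]
  have hYT : ∀ x, Y (T x) = T (Y x) := by
    intro x
    simp only [hY, ContinuousLinearMap.comp_apply, hM.commute, hN.commute]
  have hYT' : ∀ x, Y (ContinuousLinearMap.adjoint T x) = ContinuousLinearMap.adjoint T (Y x) := by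
    intro x
    simp only [hY, ContinuousLinearMap.comp_apply, hM.adj.commute, hN.adj.commute]
  have hY0 : Y = 0 := by
    apply (ContinuousLinearMap.eq_zero_of_forall_hasEigenvalue_eq_zero hYc hYs).mp
    intro μ hμ
    by_contra hμ0
    have hfd := ContinuousLinearMap.finite_dimensional_eigenspace hYc μ hμ0
    have := hMf (Module.End.eigenspace (Y : H →ₗ[ℂ] H) μ) (by
      intro x hx
      rw [Module.End.mem_eigenspace_iff] at hx
      have h3 : x = μ⁻¹ • Y x := by
        rw [show Y x = μ • x from hx, smul_smul, inv_mul_cancel₀ hμ0, one_smul]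
      rw [h3]
      exact M.smul_mem _ (Submodule.starProjection_apply_mem _ _)) (by
      constructor
      · intro x hx
        rw [Module.End.mem_eigenspace_iff] at hx ⊢
        change Y x = μ • x at hx
        change Y (T x) = _
        rw [hYT, hx, map_smul]
      · intro x hx
        rw [Module.End.mem_eigenspace_iff] at hx ⊢
        change Y x = μ • x at hx
        change Y _ = _
        rw [hYT', hx, map_smul]) hfd
    exact hμ this
  have hX0 : ∀ x ∈ M, N.starProjection x = 0 := by
    intro x hx
    have hx' := Submodule.starProjection_eq_self_iff.mpr hx
    have h3 : inner ℂ (N.starProjection x) (N.starProjection x) = inner ℂ (Y x) x := by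
      have h5 : Y x = M.starProjection (N.starProjection x) := by
        simp only [hY, ContinuousLinearMap.comp_apply, hx']
      rw [h5, Submodule.inner_starProjection_left_eq_right M (N.starProjection x) x, hx',
       ← Submodule.inner_starProjection_left_eq_right N (N.starProjection x) x,
       Submodule.starProjection_eq_self_iff.mpr (Submodule.starProjection_apply_mem _ _)]
    rw [hY0] at h3
    simpa using h3
  intro x hx
  rw [← Submodule.starProjection_apply_eq_zero_iff]
  exact hX0 x hx

theorem hp_isoms (hinf : ¬ FiniteDimensional ℂ H) : ∃ S R : H →L[ℂ] H,
    star S * S = 1 ∧ star R * R = 1 ∧ star S * R = 0 := by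
  obtain ⟨w, b, hb⟩ := exists_hilbertBasis ℂ H
  have hw : Infinite w := by
    by_contra hfin
    rw [not_infinite_iff_finite] at hfin
    have := Fintype.ofFinite w
    exact hinf (Module.Basis.finiteDimensional_of_finite b.toOrthonormalBasis.toBasis)
  obtain ⟨e⟩ : Nonempty (w ⊕ w ≃ w) := by
    rw [← Cardinal.eq, Cardinal.mk_sum]
    simp
  have key : ∀ f : w → w, Function.Injective f → ∃ S : H →L[ℂ] H, (∀ x y, inner ℂ (S x) (S y) = inner ℂ x y)
      ∧ ∀ i, S (b i) = b (f i) := by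
    classical
    intro f hf
    have ho : Orthonormal ℂ (fun i => b (f i)) := b.orthonormal.comp f hf
    let L := ho.orthogonalFamily.linearIsometry.comp b.repr.toLinearIsometry
    refine ⟨L.toContinuousLinearMap, fun x y => L.inner_map_map x y, fun i => ?_⟩
    change ho.orthogonalFamily.linearIsometry (b.repr (b i)) = _
    rw [b.repr_self, OrthogonalFamily.linearIsometry_apply_single]
    simp
  obtain ⟨S, hS, hS'⟩ := key (fun i => e (Sum.inl i)) (e.injective.comp Sum.inl_injective)
  obtain ⟨R, hR, hR'⟩ := key (fun i => e (Sum.inr i)) (e.injective.comp Sum.inr_injective)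
  have hd : Dense ((Submodule.span ℂ (Set.range b) : Submodule ℂ H) : Set H) :=
    Submodule.dense_iff_topologicalClosure_eq_top.mpr b.dense_span
  have ex : ∀ U V : H →L[ℂ] H, (∀ i, U (b i) = V (b i)) → U = V := by
    intro U V h
    refine ContinuousLinearMap.ext_on hd ?_
    rintro _ ⟨i, rfl⟩
    exact h i
  refine ⟨S, R, ?_, ?_, ?_⟩
  · ext x
    refine ext_inner_left ℂ fun y => ?_
    simp [ContinuousLinearMap.star_eq_adjoint, ContinuousLinearMap.adjoint_inner_right, hS]
  · ext x
    refine ext_inner_left ℂ fun y => ?_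
    simp [ContinuousLinearMap.star_eq_adjoint, ContinuousLinearMap.adjoint_inner_right, hR]
  · have h0 : ∀ i j, inner ℂ (S (b j)) (R (b i)) = 0 := by
      intro i j
      rw [hS', hR']
      exact b.orthonormal.2 (by simp)
    apply ex
    intro i
    simp only [ContinuousLinearMap.star_eq_adjoint, mul_apply_eq_comp,
      zero_apply]
    apply b.repr.injective
    ext j
    rw [b.repr_apply_apply, ContinuousLinearMap.adjoint_inner_right, h0, map_zero]
    rfl



theorem hp_model (hinf : ¬ FiniteDimensional ℂ H) (a : ℝ) (ha : 0 < a) (ha2 : a ≤ 1 / 2) :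
    ∃ A E : H →L[ℂ] H, ‖A‖ ≤ 1 ∧ star A * A = (1 / 4 : ℂ) • (1 : H →L[ℂ] H) + ((a ^ 2 : ℝ) : ℂ) • E ∧
      E * E = E ∧ star A * (E * A) = (1 / 4 : ℂ) • (1 : H →L[ℂ] H) := by
  obtain ⟨S, R, hS, hR, hSR⟩ := hp_isoms hinf
  have hRS : star R * S = 0 := by
    have := congrArg star hSR
    simpa using this
  have nS : ∀ U : H →L[ℂ] H, star U * U = 1 → ‖U‖ ≤ 1 := by
    intro U hU
    refine ContinuousLinearMap.opNorm_le_bound _ zero_le_one fun x => ?_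
    have h1 : inner ℂ (U x) (U x) = inner ℂ x x := by
      rw [← ContinuousLinearMap.adjoint_inner_right]
      have := congrArg (fun V : H →L[ℂ] H => V x) hU
      simp only [ContinuousLinearMap.star_eq_adjoint, mul_apply_eq_comp,
        one_apply_eq_self] at this
      rw [this]
    rw [inner_self_eq_norm_sq_to_K, inner_self_eq_norm_sq_to_K] at h1
    have h2 : ‖U x‖ ^ 2 = ‖x‖ ^ 2 := by exact_mod_cast h1
    rw [one_mul]
    exact le_of_sq_le_sq h2.le (norm_nonneg _)
  have c1 : ∀ x : H →L[ℂ] H, star S * (S * x) = x := fun x => by rw [← mul_assoc, hS, one_mul]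
  have c2 : ∀ x : H →L[ℂ] H, star R * (R * x) = x := fun x => by rw [← mul_assoc, hR, one_mul]
  have c3 : ∀ x : H →L[ℂ] H, star S * (R * x) = 0 := fun x => by rw [← mul_assoc, hSR, zero_mul]
  have c4 : ∀ x : H →L[ℂ] H, star R * (S * x) = 0 := fun x => by rw [← mul_assoc, hRS, zero_mul]
  have hs : star ((1 / 2 : ℂ)) = 1 / 2 := by simp [map_ofNat]
  have hsa : star ((a : ℂ)) = a := by simp
  refine ⟨(1 / 2 : ℂ) • S + (a : ℂ) • (R * star S), S * star S, ?_, ?_, ?_, ?_⟩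
  · refine (norm_add_le _ _).trans ?_
    rw [norm_smul, norm_smul]
    have h1 : ‖R * star S‖ ≤ 1 := by
      refine (norm_mul_le _ _).trans ?_
      rw [norm_star]
      exact mul_le_one₀ (nS R hR) (norm_nonneg _) (nS S hS)
    have h2 : ‖(1 / 2 : ℂ)‖ = 1 / 2 := by norm_num
    have h3 : ‖(a : ℂ)‖ = a := by simp [abs_of_pos ha]
    rw [h2, h3]
    nlinarith [nS S hS, norm_nonneg (R * star S)]
  · rw [star_add, star_smul, star_smul, star_mul, star_star, hs, hsa]
    simp only [add_mul, mul_add, smul_mul_assoc, mul_smul_comm, mul_assoc, c1, c2, c3, c4, hS, hR,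
      hSR, hRS, mul_zero, smul_zero, add_zero, zero_add, smul_smul]
    norm_num
    ring_nf
  · simp only [mul_assoc, c1]
  · rw [star_add, star_smul, star_smul, star_mul, star_star, hs, hsa]
    simp only [add_mul, mul_add, smul_mul_assoc, mul_smul_comm, mul_assoc, c1, c2, c3, c4, hS, hR,
      hSR, hRS, mul_zero, smul_zero, add_zero, zero_add, smul_smul]
    norm_num

theorem hp_transfer (T A : H →L[ℂ] H) (M : Submodule ℂ H) [M.HasOrthogonalProjection]
    [CompleteSpace M]
    (hT : ∀ x ∈ M, T x ∈ M) (W : H ≃ₗᵢ[ℂ] M)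
    (hK : IsCompactOperator (opRestrict T M hT - conjOp W A)) :
    ∃ J : H →L[ℂ] H, star J * J = 1 ∧ J * star J = M.starProjection ∧
      IsCompactOperator (T * M.starProjection - J * (A * star J)) := by
  let J : H →L[ℂ] H := M.subtypeL ∘L (W.toContinuousLinearEquiv : H →L[ℂ] M)
  have hJ : ∀ x, J x = (W x : H) := fun x => rfl
  have hJs : ∀ y, (star J) y = W.symm (M.orthogonalProjectionOnto y) := by
    intro y
    refine ext_inner_left ℂ fun x => ?_
    rw [ContinuousLinearMap.star_eq_adjoint, ContinuousLinearMap.adjoint_inner_right, hJ,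
      ← W.inner_map_map x, W.apply_symm_apply]
    simp
  refine ⟨J, ?_, ?_, ?_⟩
  · ext x
    simp only [mul_apply_eq_comp, one_apply_eq_self, hJs, hJ]
    simp
  · ext x
    simp only [mul_apply_eq_comp, hJs, hJ]
    simp
  · have h1 : T * M.starProjection - J * (A * star J)
        = M.subtypeL ∘L ((opRestrict T M hT - conjOp W A) ∘L M.orthogonalProjectionOnto) := by
      ext x
      simp only [ContinuousLinearMap.sub_apply, mul_apply_eq_comp, hJs, hJ]
      rfl
    rw [h1]
    exact (hK.comp_clm M.orthogonalProjectionOnto).clm_comp M.subtypeL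

theorem hp_mulC {x x' y y' : H →L[ℂ] H} (h : IsCompactOperator (x - x'))
    (h' : IsCompactOperator (y - y')) : IsCompactOperator (x * y - x' * y') := by
  have e : x * y - x' * y' = x * (y - y') + (x - x') * y' := by noncomm_ring
  rw [e]
  exact (h'.clm_comp x).add (h.comp_clm y')

theorem hp_relations (T A E J p D : H →L[ℂ] H) (c : ℂ)
    (hA1 : star A * A = (1 / 4 : ℂ) • (1 : H →L[ℂ] H) + c • E) (hE : E * E = E)
    (hA2 : star A * (E * A) = (1 / 4 : ℂ) • (1 : H →L[ℂ] H))
    (hJ : star J * J = 1) (hp : J * star J = p) (hTp : p * T = T * p)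
    (hTp' : p * star T = star T * p)
    (hD : D = star T * T - (1 / 4 : ℂ) • (1 : H →L[ℂ] H))
    (hK : IsCompactOperator (T * p - J * (A * star J))) :
    IsCompactOperator ((star T * (D * T) - (c / 4) • (1 : H →L[ℂ] H)) * p) ∧
    IsCompactOperator ((D * D - c • D) * p) := by
  have cJ : ∀ x : H →L[ℂ] H, star J * (J * x) = x := fun x => by rw [← mul_assoc, hJ, one_mul]
  have hpp : p * p = p := by
    rw [← hp]; simp only [mul_assoc, cJ]
  have hps : star p = p := by rw [← hp]; simp
  have hDp : p * D = D * p := by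
    rw [hD, mul_sub, sub_mul, ← mul_assoc, hTp', mul_assoc, hTp, ← mul_assoc]
    simp
  have hK' : IsCompactOperator (star T * p - J * (star A * star J)) := by
    have := hp_compact_adjoint _ hK
    rw [← ContinuousLinearMap.star_eq_adjoint] at this
    have e : star (T * p - J * (A * star J)) = star T * p - J * (star A * star J) := by
      rw [star_sub, star_mul, star_mul, star_mul, star_star, hps, hTp', mul_assoc]
    rwa [e] at this
  have hZ : IsCompactOperator (D * p - c • (J * (E * star J))) := by
    have h1 := hp_mulC hK' hK
    have e : star T * p * (T * p) - J * (star A * star J) * (J * (A * star J))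
        = D * p - c • (J * (E * star J)) := by
      have e1 : star T * p * (T * p) = star T * T * p := by
        rw [mul_assoc, ← mul_assoc p, hTp, mul_assoc T, hpp, mul_assoc]
      have e2 : J * (star A * star J) * (J * (A * star J)) = (1 / 4 : ℂ) • p + c • (J * (E * star J)) := by
        simp only [mul_assoc, cJ]
        rw [← mul_assoc (star A), hA1, add_mul, mul_add]
        simp only [smul_mul_assoc, mul_smul_comm, one_mul, hp]
      rw [e1, e2, hD, sub_mul, smul_mul_assoc, one_mul]
      abel
    rwa [e] at h1
  constructor
  · have h1 := hp_mulC hK' (hp_mulC hZ hK)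
    have e : star T * p * (D * p * (T * p)) - J * (star A * star J) *
        (c • (J * (E * star J)) * (J * (A * star J)))
        = (star T * (D * T) - (c / 4) • (1 : H →L[ℂ] H)) * p := by
      have e1 : star T * p * (D * p * (T * p)) = star T * (D * T) * p := by
        rw [mul_assoc D, ← mul_assoc p T, hTp, mul_assoc T, hpp, mul_assoc, ← mul_assoc p,
          hDp, mul_assoc D, ← mul_assoc p T, hTp, mul_assoc T, hpp]
        simp only [mul_assoc]
      have e2 : J * (star A * star J) * (c • (J * (E * star J)) * (J * (A * star J)))
          = (c / 4) • p := by
        simp only [mul_assoc, cJ, smul_mul_assoc, mul_smul_comm]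
        rw [← mul_assoc E, ← mul_assoc (star A), hA2]
        simp only [smul_mul_assoc, mul_smul_comm, one_mul, hp, smul_smul]
        congr 1
        ring
      rw [e1, e2, sub_mul, smul_mul_assoc, one_mul]
    rwa [e] at h1
  · have h1 := (hp_mulC hZ hZ).sub (hZ.smul c)
    have e : D * p * (D * p) - c • (J * (E * star J)) * (c • (J * (E * star J)))
        - c • (D * p - c • (J * (E * star J))) = (D * D - c • D) * p := by
      have e1 : D * p * (D * p) = D * D * p := by
        rw [mul_assoc, ← mul_assoc p, hDp, mul_assoc D, hpp, mul_assoc]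
      have e2 : c • (J * (E * star J)) * (c • (J * (E * star J))) = c • c • (J * (E * star J)) := by
        simp only [mul_assoc, cJ, smul_mul_assoc, mul_smul_comm]
        rw [← mul_assoc E, hE]
      rw [e1, e2, sub_mul, smul_mul_assoc, smul_sub]
      abel
    rw [← e]
    exact h1

end Helpers

section Final

theorem hp_part {H : Type*} [NormedAddCommGroup H] [InnerProductSpace ℂ H] [CompleteSpace H]
    (hinf : ¬ FiniteDimensional ℂ H) (T D : H →L[ℂ] H)
    (hD : D = star T * T - (1 / 4 : ℂ) • (1 : H →L[ℂ] H))
    (h : ∀ A : H →L[ℂ] H, ‖A‖ ≤ 1 → CompalentToReducingPart A T)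
    (a : ℝ) (ha : 0 < a) (ha2 : a ≤ 1 / 2) :
    ∃ M : Submodule ℂ H, IsClosed (M : Set H) ∧ HpRed T M ∧ HpNF T M ∧ M ≠ ⊥ ∧
      ∃ K : H →L[ℂ] H, IsCompactOperator K ∧
        ∀ f ∈ M, K f = (star T * (D * T)) f - ((a ^ 2 / 4 : ℝ) : ℂ) • f := by
  obtain ⟨A, E, hA, hA1, hE, hA2⟩ := hp_model hinf a ha ha2
  obtain ⟨M, hMc, hT, hT', W, hK⟩ := h A hA
  have hcs : CompleteSpace M := hMc.completeSpace_coe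
  have hM : HpRed T M := ⟨hT, hT'⟩
  obtain ⟨J, hJ, hp, hKc⟩ := hp_transfer T A M hT W hK
  have hTp : M.starProjection * T = T * M.starProjection := by
    ext x; exact hM.commute x
  have hTp' : M.starProjection * star T = star T * M.starProjection := by
    ext x; exact hM.adj.commute x
  obtain ⟨r1, r2⟩ := hp_relations T A E J M.starProjection D _ hA1 hE hA2 hJ hp hTp hTp' hD hKc
  have hMi : ¬ FiniteDimensional ℂ M := fun hf =>
    hinf (LinearEquiv.finiteDimensional W.toLinearEquiv.symm)
  have hpf : ∀ f ∈ M, M.starProjection f = f := fun f hf =>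
    Submodule.starProjection_eq_self_iff.2 hf
  have h1 : ∀ f ∈ M, ((star T * (D * T) - (((a ^ 2 : ℝ) : ℂ) / 4) • (1 : H →L[ℂ] H)) *
      M.starProjection) f = ContinuousLinearMap.adjoint T (D (T f)) -
        ((a ^ 2 / 4 : ℝ) : ℂ) • f := by
    intro f hf
    rw [ContinuousLinearMap.mul_apply, hpf f hf]
    push_cast
    rfl
  have h2 : ∀ f ∈ M, ((D * D - ((a ^ 2 : ℝ) : ℂ) • D) *
      M.starProjection) f = D (D f) - ((a ^ 2 : ℝ) : ℂ) • D f := by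
    intro f hf
    rw [ContinuousLinearMap.mul_apply, hpf f hf]
    rfl
  have hD' : ∀ x, D x = ContinuousLinearMap.adjoint T (T x) - (1 / 4 : ℂ) • x := by
    intro x; rw [hD]; rfl
  obtain ⟨M', hle, hc, hr, hnf, hne⟩ := hp_trim T D a ha ha2 hD' M hMc hM hMi _ _ r1 r2 h1 h2
  exact ⟨M', hc, hr, hnf, hne, _, r1, fun f hf => h1 f (hle hf)⟩

theorem hp_cross {H : Type*} [NormedAddCommGroup H] [InnerProductSpace ℂ H] [CompleteSpace H]
    (T w K L : H →L[ℂ] H) (c d : ℂ) (hcd : c ≠ d) (M N : Submodule ℂ H)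
    [M.HasOrthogonalProjection] [N.HasOrthogonalProjection]
    (hM : HpRed T M) (hN : HpRed T N) (hMf : HpNF T M)
    (hw : N.starProjection * w = w * N.starProjection)
    (hK : IsCompactOperator K) (hL : IsCompactOperator L)
    (h1 : ∀ f ∈ M, K f = w f - c • f) (h2 : ∀ f ∈ N, L f = w f - d • f) : M ⟂ N := by
  apply hp_orth T M N hM hN hMf
  have e1 : IsCompactOperator (N.starProjection ∘L (K ∘L M.starProjection)) :=
    (hK.comp_clm M.starProjection).clm_comp N.starProjection
  have e2 : IsCompactOperator (L ∘L (N.starProjection ∘L M.starProjection)) :=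
    hL.comp_clm (N.starProjection ∘L M.starProjection)
  have e3 := (e2.sub e1).smul ((c - d)⁻¹)
  refine (congrArg IsCompactOperator (funext fun x => ?_)).mpr e3
  have hx : M.starProjection x ∈ M := Submodule.starProjection_apply_mem _ _
  have hy : N.starProjection (M.starProjection x) ∈ N := Submodule.starProjection_apply_mem _ _
  have hw' : N.starProjection (w (M.starProjection x)) = w (N.starProjection (M.starProjection x)) :=
    DFunLike.congr_fun hw (M.starProjection x)
  simp only [Pi.smul_apply, Pi.sub_apply, ContinuousLinearMap.comp_apply, h1 _ hx, h2 _ hy,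
    map_sub, map_smul, hw']
  rw [sub_sub_sub_cancel_left, ← sub_smul, smul_smul, inv_mul_cancel₀ (sub_ne_zero.2 hcd), one_smul]

end Final

/-- **Corollary 2.7, second part.** There is no operator `T` such that every
contraction on `H` is compalent to a reducing part of `T`. -/
theorem stmt9 {H : Type*} [NormedAddCommGroup H] [InnerProductSpace ℂ H] [CompleteSpace H]
    [TopologicalSpace.SeparableSpace H] (hinf : ¬ FiniteDimensional ℂ H) :
    ¬ ∃ T : H →L[ℂ] H, ∀ A : H →L[ℂ] H, ‖A‖ ≤ 1 → CompalentToReducingPart A T := by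
  rintro ⟨T, h⟩
  set D := star T * T - (1 / 4 : ℂ) • (1 : H →L[ℂ] H) with hD
  have key := fun a : Set.Ioc (0 : ℝ) (1 / 2) => hp_part hinf T D hD h a.1 a.2.1 a.2.2
  choose M hMc hMr hMf hMn K hK hKe using key
  have hcs : ∀ a, CompleteSpace (M a) := fun a => (hMc a).completeSpace_coe
  have hv : ∀ a, ∃ v ∈ M a, ‖v‖ = 1 := by
    intro a
    obtain ⟨u, hu, hu0⟩ := Submodule.exists_mem_ne_zero_of_ne_bot (hMn a)
    exact ⟨((‖u‖⁻¹ : ℝ) : ℂ) • u, (M a).smul_mem _ hu, by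
      rw [norm_smul]; simp [hu0]⟩
  choose v hvM hv1 using hv
  have hort : ∀ a b, a ≠ b → M a ⟂ M b := by
    intro a b hab
    refine hp_cross T (star T * (D * T)) (K a) (K b) _ _ ?_ (M a) (M b) (hMr a) (hMr b) (hMf a)
      ?_ (hK a) (hK b) (hKe a) (hKe b)
    · intro hc
      apply hab
      have h3 : (a.1 ^ 2 / 4 : ℝ) = b.1 ^ 2 / 4 := by exact_mod_cast hc
      have h4 : a.1 ^ 2 = b.1 ^ 2 := by linarith
      exact Subtype.ext ((sq_eq_sq₀ a.2.1.le b.2.1.le).1 h4)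
    · have c1 : (M b).starProjection * T = T * (M b).starProjection := by
        ext x; exact (hMr b).commute x
      have c2 : (M b).starProjection * star T = star T * (M b).starProjection := by
        ext x; exact (hMr b).adj.commute x
      have k1 : Commute (M b).starProjection T := c1
      have k2 : Commute (M b).starProjection (star T) := c2
      have k3 : Commute (M b).starProjection D :=
        (k2.mul_right k1).sub_right ((Commute.one_right _).smul_right _)
      exact (k2.mul_right (k3.mul_right k1)).eq
  have hcount : Countable (Set.Ioc (0 : ℝ) (1 / 2)) := by
    refine Pairwise.countable_of_isOpen_disjoint (s := fun a => Metric.ball (v a) (1 / 2)) ?_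
      (fun _ => Metric.isOpen_ball) (fun a => ⟨v a, Metric.mem_ball_self (by norm_num)⟩)
    intro a b hab
    apply Metric.ball_disjoint_ball
    rw [dist_eq_norm]
    have h0 : inner ℂ (v a) (v b) = 0 := (hort a b hab).inner_eq (hvM a) (hvM b)
    have := norm_sub_sq (𝕜 := ℂ) (v a) (v b)
    rw [h0, hv1, hv1] at this
    simp at this
    nlinarith [norm_nonneg (v a - v b)]
  have := Cardinal.Real.Ioc_countable_iff.1 (Set.countable_coe_iff.1 hcount)
  norm_num at this
end

section
/- Let H be a separable infinite-dimensional complex Hilbert space. If (T_n) is a sequence of normal bounded operators on H converging in the strong operator topology to a bounded operator T, then T is subnormal; that is, there exist a complex Hilbert space G, a normal bounded operator N on G, and a closed subspace M of G invariant under N, such that T is unitarily equivalent to the restriction of N to M. -/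
open Filter Topology ContinuousLinearMap

universe u


section Ultra

variable (H : Type u) [NormedAddCommGroup H] [InnerProductSpace ℂ H]

/-- Bounded sequences. -/
def bddSub : Submodule ℂ (ℕ → H) where
  carrier := {x | ∃ C : ℝ, ∀ n, ‖x n‖ ≤ C}
  add_mem' := by
    rintro a b ⟨C, hC⟩ ⟨D, hD⟩
    exact ⟨C + D, fun n => (norm_add_le _ _).trans (add_le_add (hC n) (hD n))⟩
  zero_mem' := ⟨0, fun n => by simp⟩
  smul_mem' := by
    rintro c x ⟨C, hC⟩
    refine ⟨‖c‖ * C, fun n => ?_⟩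
    simp only [Pi.smul_apply, norm_smul]
    exact mul_le_mul_of_nonneg_left (hC n) (norm_nonneg _)

/-- Bounded sequences, as a type without topology. -/
def BSeq : Type u := bddSub H

instance : AddCommGroup (BSeq H) := inferInstanceAs (AddCommGroup (bddSub H))
instance : Module ℂ (BSeq H) := inferInstanceAs (Module ℂ (bddSub H))

variable {H}

/-- Values. -/
def BSeq.val (x : BSeq H) : ℕ → H := Subtype.val x

theorem BSeq.bdd (x : BSeq H) : ∃ C : ℝ, ∀ n, ‖x.val n‖ ≤ C := Subtype.property x

theorem BSeq.val_add (x y : BSeq H) (n : ℕ) : (x + y).val n = x.val n + y.val n := rfl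
theorem BSeq.val_smul (c : ℂ) (x : BSeq H) (n : ℕ) : (c • x).val n = c • x.val n := rfl

/-- Limit along the ultrafilter of inner products. -/
noncomputable def BSeq.ip (x y : BSeq H) : ℂ :=
  limUnder (hyperfilter ℕ : Filter ℕ) (fun n => inner ℂ (x.val n) (y.val n))

theorem BSeq.tendsto_ip (x y : BSeq H) :
    Tendsto (fun n => inner ℂ (x.val n) (y.val n)) (hyperfilter ℕ : Filter ℕ) (𝓝 (x.ip y)) := by
  obtain ⟨C, hC⟩ := x.bdd
  obtain ⟨D, hD⟩ := y.bdd
  have hK : IsCompact (Metric.closedBall (0 : ℂ) (C * D)) := isCompact_closedBall _ _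
  obtain ⟨a, -, ha⟩ := isCompact_iff_ultrafilter_le_nhds.1 hK
    ((hyperfilter ℕ).map (fun n => (inner ℂ (x.val n) (y.val n) : ℂ))) (by
      rw [Filter.le_principal_iff]
      refine Filter.Eventually.of_forall (f := (hyperfilter ℕ : Filter ℕ)) (fun n => ?_)
      simp only [Metric.mem_closedBall, dist_zero_right]
      exact (norm_inner_le_norm _ _).trans
        (mul_le_mul (hC n) (hD n) (norm_nonneg _) ((norm_nonneg _).trans (hC n))))
  exact tendsto_nhds_limUnder ⟨a, ha⟩

theorem BSeq.ip_eq {x y : BSeq H} {a : ℂ}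
    (h : Tendsto (fun n => inner ℂ (x.val n) (y.val n)) (hyperfilter ℕ : Filter ℕ) (𝓝 a)) :
    x.ip y = a := tendsto_nhds_unique (x.tendsto_ip y) h

/-- The pre-inner product. -/
noncomputable instance BSeq.core : PreInnerProductSpace.Core ℂ (BSeq H) where
  inner x y := x.ip y
  conj_inner_symm x y := by
    refine (BSeq.ip_eq ?_).symm
    have := (Complex.continuous_conj.tendsto _).comp (y.tendsto_ip x)
    refine this.congr fun n => ?_
    simp
  re_inner_nonneg x := by
    have := (Complex.continuous_re.tendsto _).comp (x.tendsto_ip x)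
    refine ge_of_tendsto' this fun n => ?_
    exact inner_self_nonneg (𝕜 := ℂ)
  add_left x y z := by
    refine BSeq.ip_eq ?_
    refine ((x.tendsto_ip z).add (y.tendsto_ip z)).congr fun n => ?_
    rw [BSeq.val_add, inner_add_left]
  smul_left x y r := by
    refine BSeq.ip_eq ?_
    refine ((x.tendsto_ip y).const_mul _).congr fun n => ?_
    rw [BSeq.val_smul, inner_smul_left]

noncomputable instance : SeminormedAddCommGroup (BSeq H) :=
  InnerProductSpace.Core.toSeminormedAddCommGroup (𝕜 := ℂ)
noncomputable instance : InnerProductSpace ℂ (BSeq H) := InnerProductSpace.ofCore BSeq.core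

theorem BSeq.inner_def (x y : BSeq H) : inner ℂ x y = x.ip y := rfl

theorem BSeq.tendsto_norm (x : BSeq H) :
    Tendsto (fun n => ‖x.val n‖ ^ 2) (hyperfilter ℕ : Filter ℕ) (𝓝 (‖x‖ ^ 2)) := by
  have := (Complex.continuous_re.tendsto _).comp (x.tendsto_ip x)
  rw [← BSeq.inner_def] at this
  have h2 : (inner ℂ x x : ℂ).re = ‖x‖ ^ 2 := inner_self_eq_norm_sq (𝕜 := ℂ) x
  rw [h2] at this
  refine this.congr fun n => ?_
  exact inner_self_eq_norm_sq (𝕜 := ℂ) (x.val n)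

/-- The operator given by a bounded sequence of operators. -/
noncomputable def BSeq.op (A : ℕ → H →L[ℂ] H) (C : ℝ) (hA : ∀ n, ‖A n‖ ≤ C) :
    BSeq H →L[ℂ] BSeq H :=
  LinearMap.mkContinuous
    { toFun := fun x => ⟨fun n => A n (x.val n), by
        obtain ⟨D, hD⟩ := x.bdd
        exact ⟨C * D, fun n => (A n).le_of_opNorm_le_of_le (hA n) (hD n)⟩⟩
      map_add' := fun x y => Subtype.ext (funext fun n => (A n).map_add _ _)
      map_smul' := fun c x => Subtype.ext (funext fun n => (A n).map_smul _ _) } C (by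
    intro x
    have hC : 0 ≤ C := (norm_nonneg _).trans (hA 0)
    refine le_of_sq_le_sq ?_ (by positivity)
    rw [mul_pow]
    refine le_of_tendsto_of_tendsto' (BSeq.tendsto_norm _) (x.tendsto_norm.const_mul _) fun n => ?_
    rw [← mul_pow]
    exact pow_le_pow_left₀ (norm_nonneg _) ((A n).le_of_opNorm_le (hA n) _) 2)

theorem BSeq.op_val (A : ℕ → H →L[ℂ] H) (C : ℝ) (hA : ∀ n, ‖A n‖ ≤ C) (x : BSeq H) (n : ℕ) :
    (BSeq.op A C hA x).val n = A n (x.val n) := rfl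

/-- Constant sequences. -/
noncomputable def BSeq.const : H →ₗᵢ[ℂ] BSeq H where
  toFun x := ⟨fun _ => x, ‖x‖, fun _ => le_rfl⟩
  map_add' x y := rfl
  map_smul' c x := rfl
  norm_map' x := by
    refine (pow_left_inj₀ (norm_nonneg _) (norm_nonneg _) two_ne_zero).1 ?_
    exact tendsto_nhds_unique (BSeq.tendsto_norm _) tendsto_const_nhds

theorem BSeq.const_val (x : H) (n : ℕ) : (BSeq.const x).val n = x := rfl

open UniformSpace in
/-- Extension of an operator to the completion. -/
noncomputable def complOp {E : Type u} [SeminormedAddCommGroup E] [InnerProductSpace ℂ E]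
    (A : E →L[ℂ] E) : Completion E →L[ℂ] Completion E :=
  ((Completion.toComplL : E →L[ℂ] Completion E).comp A).extend
    (Completion.toComplL : E →L[ℂ] Completion E)

open UniformSpace in
theorem complOp_coe {E : Type u} [SeminormedAddCommGroup E] [InnerProductSpace ℂ E]
    (A : E →L[ℂ] E) (x : E) : complOp A (x : Completion E) = (A x : Completion E) :=
  ContinuousLinearMap.extend_eq _ (e := (Completion.toComplL : E →L[ℂ] Completion E))
    Completion.denseRange_coe (Completion.isUniformInducing_coe E) x

end Ultra

/-- The strong limit of a sequence of normal operators is subnormal: it is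
unitarily equivalent to the restriction of a normal operator (on a possibly nonseparable Hilbert
space) to a closed invariant subspace. -/
theorem stmt10 {H : Type u} [NormedAddCommGroup H] [InnerProductSpace ℂ H] [CompleteSpace H]
    [TopologicalSpace.SeparableSpace H] (hinf : ¬ FiniteDimensional ℂ H)
    (T : H →L[ℂ] H) (Tn : ℕ → H →L[ℂ] H)
    (hnormal : ∀ n, (Tn n).comp (ContinuousLinearMap.adjoint (Tn n)) =
      (ContinuousLinearMap.adjoint (Tn n)).comp (Tn n))
    (hlim : ∀ x : H, Filter.Tendsto (fun n => Tn n x) Filter.atTop (nhds (T x))) :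
    ∃ (G : Type u) (_ : NormedAddCommGroup G) (_ : InnerProductSpace ℂ G) (_ : CompleteSpace G)
      (N : G →L[ℂ] G),
      N.comp (ContinuousLinearMap.adjoint N) = (ContinuousLinearMap.adjoint N).comp N ∧
      ∃ (M : Submodule ℂ G) (_ : IsClosed (M : Set G)) (hinv : ∀ x ∈ M, N x ∈ M)
        (W : H ≃ₗᵢ[ℂ] M), opRestrict N M hinv = conjOp W T := by
  obtain ⟨C, hC⟩ : ∃ C, ∀ n, ‖Tn n‖ ≤ C := banach_steinhaus fun x => by
    obtain ⟨D, hD⟩ := (Metric.isBounded_range_of_tendsto _ (hlim x)).exists_norm_le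
    exact ⟨D, fun n => hD _ ⟨n, rfl⟩⟩
  have hC' : ∀ n, ‖ContinuousLinearMap.adjoint (Tn n)‖ ≤ C := fun n => by
    rw [LinearIsometryEquiv.norm_map]; exact hC n
  let A := BSeq.op Tn C hC
  let B := BSeq.op (fun n => ContinuousLinearMap.adjoint (Tn n)) C hC'
  have hadj : complOp B = ContinuousLinearMap.adjoint (complOp A) := by
    rw [ContinuousLinearMap.eq_adjoint_iff]
    intro x y
    refine UniformSpace.Completion.induction_on₂ x y
      (isClosed_eq (by fun_prop) (by fun_prop)) fun a b => ?_
    rw [complOp_coe, complOp_coe, UniformSpace.Completion.inner_coe,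
      UniformSpace.Completion.inner_coe]
    refine BSeq.ip_eq ((a.tendsto_ip (A b)).congr fun n => ?_)
    exact (ContinuousLinearMap.adjoint_inner_left (Tn n) _ _).symm
  let W₀ : H →ₗᵢ[ℂ] UniformSpace.Completion (BSeq H) :=
    UniformSpace.Completion.toComplₗᵢ.comp BSeq.const
  have hW : ∀ x, complOp A (W₀ x) = W₀ (T x) := by
    intro x
    change complOp A ((BSeq.const x : BSeq H) : UniformSpace.Completion (BSeq H)) =
      ((BSeq.const (T x) : BSeq H) : UniformSpace.Completion (BSeq H))
    rw [complOp_coe, ← sub_eq_zero, ← UniformSpace.Completion.coe_sub, ← norm_eq_zero,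
      UniformSpace.Completion.norm_coe]
    have h1 : Tendsto (fun n => ‖Tn n x - T x‖ ^ 2) (hyperfilter ℕ : Filter ℕ) (𝓝 (0 ^ 2)) :=
      ((tendsto_iff_norm_sub_tendsto_zero.1 (hlim x)).pow 2).mono_left Nat.hyperfilter_le_atTop
    have h2 := tendsto_nhds_unique (BSeq.tendsto_norm (A (BSeq.const x) - BSeq.const (T x))) h1
    simpa using h2
  refine ⟨UniformSpace.Completion (BSeq H), inferInstance, inferInstance, inferInstance,
    complOp A, ?_, LinearMap.range W₀.toLinearMap, ?_, ?_, W₀.equivRange, ?_⟩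
  · rw [← hadj]
    ext x
    refine UniformSpace.Completion.induction_on x
      (isClosed_eq (by fun_prop) (by fun_prop)) fun a => ?_
    simp only [ContinuousLinearMap.comp_apply, complOp_coe]
    congr 1
    refine Subtype.ext (funext fun n => ?_)
    exact DFunLike.congr_fun (hnormal n) (a.val n)
  · exact W₀.isometry.isClosedEmbedding.isClosed_range
  · rintro _ ⟨x, rfl⟩
    exact ⟨T x, (hW x).symm⟩
  · ext ⟨_, x, rfl⟩
    have : W₀.equivRange.symm ⟨W₀ x, x, rfl⟩ = x :=
      W₀.equivRange.symm_apply_apply x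
    change complOp A (W₀ x) = W₀ (T (W₀.equivRange.symm ⟨W₀ x, x, rfl⟩))
    rw [this, hW]
end

section
/- Let H be a separable infinite-dimensional complex Hilbert space and let T and K be compact operators on H. If T and K are approximately unitarily equivalent, then T ⊕ 0_H is unitarily equivalent to K ⊕ 0_H, where 0_H denotes the zero operator on H. -/
open Filter Topology ContinuousLinearMap

/-- The direct sum `T ⊕ S` of two operators, acting on the Hilbert space direct sum
`H₁ ⊕ H₂ = WithLp 2 (H₁ × H₂)`. -/
noncomputable def dSum {H₁ H₂ : Type*} [NormedAddCommGroup H₁] [InnerProductSpace ℂ H₁]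
    [NormedAddCommGroup H₂] [InnerProductSpace ℂ H₂]
    (T : H₁ →L[ℂ] H₁) (S : H₂ →L[ℂ] H₂) :
    WithLp 2 (H₁ × H₂) →L[ℂ] WithLp 2 (H₁ × H₂) :=
  (((WithLp.prodContinuousLinearEquiv 2 ℂ H₁ H₂).symm : H₁ × H₂ →L[ℂ] WithLp 2 (H₁ × H₂)).comp
    (T.prodMap S)).comp
    ((WithLp.prodContinuousLinearEquiv 2 ℂ H₁ H₂ : WithLp 2 (H₁ × H₂) →L[ℂ] H₁ × H₂))

/-- Two operators are approximately unitarily equivalent if there is a sequence of unitaries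
`Wₙ` with `T₂ - Wₙ T₁ Wₙ*` compact for all `n` and `‖T₂ - Wₙ T₁ Wₙ*‖ → 0`. -/
def ApproxUnitEquiv {H : Type*} [NormedAddCommGroup H] [InnerProductSpace ℂ H]
    (T₁ T₂ : H →L[ℂ] H) : Prop :=
  ∃ W : ℕ → (H ≃ₗᵢ[ℂ] H),
    (∀ n, IsCompactOperator (T₂ - conjOp (W n) T₁)) ∧
    Filter.Tendsto (fun n => ‖T₂ - conjOp (W n) T₁‖) Filter.atTop (nhds 0)

open scoped InnerProductSpace

theorem aux_l2 {E : Type*} [NormedAddCommGroup E] [InnerProductSpace ℂ E] [CompleteSpace E]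
    [TopologicalSpace.SeparableSpace E] (hinf : ¬ FiniteDimensional ℂ E) :
    Nonempty (HilbertBasis ℕ ℂ E) := by
  obtain ⟨w, b, hb⟩ := exists_hilbertBasis ℂ E
  have hc : Countable w := by
    have hdis : Pairwise (Function.onFun Disjoint (fun i : w => Metric.ball (b i) (1/2))) := by
      intro i j hij
      apply Metric.ball_disjoint_ball
      have h1 := b.orthonormal.1 i
      have h2 := b.orthonormal.1 j
      have h3 : ⟪b i, b j⟫_ℂ = 0 := b.orthonormal.2 hij
      have h4 := norm_sub_sq (𝕜 := ℂ) (b i) (b j)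
      rw [h1, h2, h3] at h4
      simp at h4
      rw [dist_eq_norm]
      nlinarith [norm_nonneg (b i - b j)]
    exact hdis.countable_of_isOpen_disjoint (fun i => Metric.isOpen_ball)
      (fun i => ⟨b i, Metric.mem_ball_self (by norm_num)⟩)
  have hi : Infinite w := by
    by_contra h
    rw [not_infinite_iff_finite] at h
    have := Fintype.ofFinite w
    exact hinf (b.toOrthonormalBasis.toBasis.finiteDimensional_of_finite)
  obtain ⟨e⟩ := nonempty_equiv_of_countable (α := w) (β := ℕ)
  refine ⟨HilbertBasis.mk (v := fun n => b (e.symm n))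
    (b.orthonormal.comp _ e.symm.injective) ?_⟩
  have : Set.range (fun n => b (e.symm n)) = Set.range b := e.symm.surjective.range_comp b
  rw [this, b.dense_span]

noncomputable def auxProd {A B C D : Type*} [NormedAddCommGroup A] [InnerProductSpace ℂ A]
    [NormedAddCommGroup B] [InnerProductSpace ℂ B] [NormedAddCommGroup C] [InnerProductSpace ℂ C]
    [NormedAddCommGroup D] [InnerProductSpace ℂ D] (e : A ≃ₗᵢ[ℂ] C) (f : B ≃ₗᵢ[ℂ] D) :
    WithLp 2 (A × B) ≃ₗᵢ[ℂ] WithLp 2 (C × D) where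
  toLinearEquiv := (WithLp.linearEquiv 2 ℂ (A × B)).trans
    ((LinearEquiv.prodCongr e.toLinearEquiv f.toLinearEquiv).trans
      (WithLp.linearEquiv 2 ℂ (C × D)).symm)
  norm_map' x := by
    rw [← sq_eq_sq₀ (by positivity) (by positivity), WithLp.prod_norm_sq_eq_of_L2,
      WithLp.prod_norm_sq_eq_of_L2]
    simp

theorem aux_glue {A E : Type*} [NormedAddCommGroup A] [InnerProductSpace ℂ A] [CompleteSpace A]
    [NormedAddCommGroup E] [InnerProductSpace ℂ E] [CompleteSpace E]
    [TopologicalSpace.SeparableSpace E] (J₁ J₂ : A →ₗᵢ[ℂ] E)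
    (h₁ : ¬ FiniteDimensional ℂ (LinearMap.range J₁.toLinearMap)ᗮ)
    (h₂ : ¬ FiniteDimensional ℂ (LinearMap.range J₂.toLinearMap)ᗮ) :
    ∃ W : E ≃ₗᵢ[ℂ] E, (∀ a, W (J₁ a) = J₂ a) ∧
      ∀ x ∈ (LinearMap.range J₁.toLinearMap)ᗮ, W x ∈ (LinearMap.range J₂.toLinearMap)ᗮ := by
  have hs : SecondCountableTopology E := UniformSpace.secondCountable_of_separable E
  have c₁ : CompleteSpace (LinearMap.range J₁.toLinearMap) :=
    (J₁.isometry.isUniformInducing.isComplete_range).completeSpace_coe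
  have c₂ : CompleteSpace (LinearMap.range J₂.toLinearMap) :=
    (J₂.isometry.isUniformInducing.isComplete_range).completeSpace_coe
  obtain ⟨b₁⟩ := aux_l2 h₁
  obtain ⟨b₂⟩ := aux_l2 h₂
  let f := b₁.repr.trans b₂.repr.symm
  let e := J₁.equivRange.symm.trans J₂.equivRange
  let S₁ := LinearMap.range J₁.toLinearMap
  let S₂ := LinearMap.range J₂.toLinearMap
  have key : ∀ x, (S₁.orthogonalDecomposition.trans
      ((auxProd e f).trans S₂.orthogonalDecomposition.symm)) x =
      (e (S₁.orthogonalProjectionOnto x) : E) + (f (S₁ᗮ.orthogonalProjectionOnto x) : E) := by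
    intro x
    simp only [LinearIsometryEquiv.trans_apply, Submodule.orthogonalDecomposition_apply]
    rfl
  refine ⟨S₁.orthogonalDecomposition.trans
      ((auxProd e f).trans S₂.orthogonalDecomposition.symm), ?_, ?_⟩
  · intro a
    rw [key]
    have ha : J₁ a ∈ S₁ := ⟨a, rfl⟩
    have e1 : S₁.orthogonalProjectionOnto (J₁ a) = J₁.equivRange a :=
      Submodule.orthogonalProjectionOnto_mem_subspace_eq_self (K := S₁) (J₁.equivRange a)
    have e2 : S₁ᗮ.orthogonalProjectionOnto (J₁ a) = 0 := by
      apply Submodule.orthogonalProjectionOnto_eq_zero_iff.2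
      exact Submodule.le_orthogonal_orthogonal _ ha
    rw [e1, e2]
    simp only [e, LinearIsometryEquiv.trans_apply, LinearIsometryEquiv.symm_apply_apply, map_zero,
      Submodule.coe_zero, add_zero]
    rfl
  · intro x hx
    rw [key]
    have e1 : S₁.orthogonalProjectionOnto x = 0 :=
      Submodule.orthogonalProjectionOnto_eq_zero_iff.2 hx
    rw [e1, map_zero, Submodule.coe_zero, zero_add]
    exact Subtype.property _

section lim
variable {H : Type*} [NormedAddCommGroup H] [InnerProductSpace ℂ H] [CompleteSpace H]

theorem aux_adj (T K : H →L[ℂ] H) (W : H ≃ₗᵢ[ℂ] H) (ε : ℝ)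
    (h : ∀ x, ‖W (T x) - K (W x)‖ ≤ ε * ‖x‖) (x : H) :
    ‖W (adjoint T x) - adjoint K (W x)‖ ≤ ε * ‖x‖ := by
  set z := W (adjoint T x) - adjoint K (W x) with hz
  have h1 : ⟪z, z⟫_ℂ = ⟪W (T (W.symm z)) - K (W (W.symm z)), W x⟫_ℂ := by
    have h3 : ⟪z, z⟫_ℂ = ⟪z, W (adjoint T x)⟫_ℂ - ⟪z, adjoint K (W x)⟫_ℂ := by
      rw [← inner_sub_right, ← hz]
    have h4 : ⟪z, W (adjoint T x)⟫_ℂ = ⟪W (T (W.symm z)), W x⟫_ℂ := by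
      rw [W.inner_map_map, ← adjoint_inner_right T, ← W.inner_map_map (W.symm z),
        W.apply_symm_apply]
    rw [h3, h4, adjoint_inner_right K, inner_sub_left, W.apply_symm_apply]
  have h2 : ‖z‖ * ‖z‖ ≤ (ε * ‖x‖) * ‖z‖ := by
    have h3 : ‖⟪z, z⟫_ℂ‖ = ‖z‖ * ‖z‖ := by
      rw [inner_self_eq_norm_sq_to_K]; simp [sq]
    rw [← h3, h1]
    refine (norm_inner_le_norm _ _).trans ?_
    have := h (W.symm z)
    rw [W.norm_map]
    rw [W.symm.norm_map] at this
    nlinarith [norm_nonneg x]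
  by_cases h0 : ‖z‖ = 0
  · rw [h0]
    have := (norm_nonneg _).trans (h x)
    exact this
  · exact le_of_mul_le_mul_right h2 (lt_of_le_of_ne (norm_nonneg _) (Ne.symm h0))

theorem aux_symm (T K : H →L[ℂ] H) (W : H ≃ₗᵢ[ℂ] H) (ε : ℝ)
    (h : ∀ x, ‖W (T x) - K (W x)‖ ≤ ε * ‖x‖) (x : H) :
    ‖W.symm (K x) - T (W.symm x)‖ ≤ ε * ‖x‖ := by
  have := h (W.symm x)
  rw [W.symm.norm_map, W.apply_symm_apply, norm_sub_rev] at this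
  rw [← W.norm_map, map_sub, W.apply_symm_apply]
  exact this

theorem aux_transfer (T K : H →L[ℂ] H) (W : ℕ → H ≃ₗᵢ[ℂ] H) (ε : ℕ → ℝ) (F : Filter ℕ)
    (hε : Tendsto ε F (𝓝 0))
    (h : ∀ n x, ‖W n (T x) - K (W n x)‖ ≤ ε n * ‖x‖) (x z : H)
    (hz : Tendsto (fun n => K (W n x)) F (𝓝 z)) : Tendsto (fun n => W n (T x)) F (𝓝 z) := by
  have h0 : Tendsto (fun n => W n (T x) - K (W n x)) F (𝓝 0) :=
    squeeze_zero_norm (fun n => h n x) (by simpa using hε.mul_const ‖x‖)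
  simpa using h0.add hz

theorem aux_conv (T K : H →L[ℂ] H) (hK : IsCompactOperator K) (W : ℕ → H ≃ₗᵢ[ℂ] H) (ε : ℕ → ℝ)
    (F : Ultrafilter ℕ) (hε : Tendsto ε F (𝓝 0))
    (h : ∀ n x, ‖W n (T x) - K (W n x)‖ ≤ ε n * ‖x‖) (x : H) :
    ∃ z, Tendsto (fun n => W n (T x)) F (𝓝 z) := by
  obtain ⟨C, hC, hsub⟩ := hK.image_closedBall_subset_compact (f := (K : H →ₗ[ℂ] H)) ‖x‖
  have hm : (F.map (fun n => K (W n x)) : Filter H) ≤ 𝓟 C := by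
    rw [le_principal_iff]
    refine Filter.mem_map.2 (Filter.univ_mem' fun n => hsub ⟨W n x, ?_, rfl⟩)
    simp
  obtain ⟨z, -, hz⟩ := hC.ultrafilter_le_nhds _ hm
  exact ⟨z, aux_transfer T K W ε F hε h x z hz⟩

theorem aux_conv2 (T K : H →L[ℂ] H) (hK : IsCompactOperator K) (W : ℕ → H ≃ₗᵢ[ℂ] H) (ε : ℕ → ℝ)
    (F : Ultrafilter ℕ) (hε : Tendsto ε F (𝓝 0))
    (h : ∀ n x, ‖W n (T x) - K (W n x)‖ ≤ ε n * ‖x‖) (x : H) :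
    ∃ z, Tendsto (fun n => W n (adjoint T (T x))) F (𝓝 z) := by
  obtain ⟨z, hz⟩ := aux_conv T K hK W ε F hε h x
  exact ⟨adjoint K z, aux_transfer (adjoint T) (adjoint K) W ε F hε
    (fun n => aux_adj T K (W n) (ε n) (h n)) (T x) _ (((adjoint K).continuous.tendsto z).comp hz)⟩

def auxA (W : ℕ → H ≃ₗᵢ[ℂ] H) (F : Ultrafilter ℕ) : Submodule ℂ H where
  carrier := {y | ∃ z, Tendsto (fun n => W n y) F (𝓝 z)}
  add_mem' := by
    rintro a b ⟨z, hz⟩ ⟨z', hz'⟩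
    exact ⟨z + z', by simpa using hz.add hz'⟩
  zero_mem' := ⟨0, by simpa using tendsto_const_nhds⟩
  smul_mem' := by
    rintro c a ⟨z, hz⟩
    exact ⟨c • z, by simpa using hz.const_smul c⟩

theorem auxA_closed (W : ℕ → H ≃ₗᵢ[ℂ] H) (F : Ultrafilter ℕ) :
    IsClosed (auxA W F : Set H) := by
  refine isClosed_of_closure_subset fun y hy => ?_
  suffices hC : Cauchy (Filter.map (fun n => W n y) (F : Filter ℕ)) from
    CompleteSpace.complete hC
  rw [Metric.cauchy_iff]
  refine ⟨inferInstance, fun δ hδ => ?_⟩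
  obtain ⟨a, ⟨z, hz⟩, ha⟩ := Metric.mem_closure_iff.1 hy (δ/4) (by positivity)
  refine ⟨Metric.ball z (δ/2), ?_, ?_⟩
  · rw [Filter.mem_map]
    filter_upwards [Metric.tendsto_nhds.1 hz (δ/4) (by positivity)] with n hn
    have : dist (W n y) (W n a) = dist y a := (W n).dist_map y a
    have h3 := dist_triangle (W n y) (W n a) z
    simp only [Set.mem_preimage, Metric.mem_ball]
    linarith
  · intro x hx x' hx'
    have := dist_triangle_right x x' z
    simp only [Metric.mem_ball] at hx hx'
    linarith

theorem aux_L (W : ℕ → H ≃ₗᵢ[ℂ] H) (F : Ultrafilter ℕ) :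
    ∃ L : auxA W F →ₗᵢ[ℂ] H, ∀ a : auxA W F, Tendsto (fun n => W n (a : H)) F (𝓝 (L a)) := by
  choose L hL using fun a : auxA W F => a.2
  refine ⟨⟨⟨⟨L, ?_⟩, ?_⟩, ?_⟩, hL⟩
  · intro a b
    refine tendsto_nhds_unique (hL (a + b)) ?_
    simpa using (hL a).add (hL b)
  · intro c a
    refine tendsto_nhds_unique (hL (c • a)) ?_
    simpa using (hL a).const_smul c
  · intro a
    refine tendsto_nhds_unique (hL a).norm ?_
    simp

theorem aux_main_s11 (T K : H →L[ℂ] H) (hT : IsCompactOperator T) (hK : IsCompactOperator K)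
    (h : ApproxUnitEquiv T K) :
    ∃ (A : Submodule ℂ H) (_ : IsClosed (A : Set H)) (L : A →ₗᵢ[ℂ] H) (S : A → A),
      (∀ a : A, T a = S a) ∧ (∀ a, K (L a) = L (S a)) ∧ (∀ x ∈ Aᗮ, T x = 0) ∧
      (∀ x ∈ (LinearMap.range L.toLinearMap)ᗮ, K x = 0) := by
  obtain ⟨W, -, hε'⟩ := h
  set ε : ℕ → ℝ := fun n => ‖K - conjOp (W n) T‖ with hεd
  let F : Ultrafilter ℕ := hyperfilter ℕ
  have hF : (F : Filter ℕ) ≤ atTop := by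
    rw [← Nat.cofinite_eq_atTop]; exact hyperfilter_le_cofinite
  have hε : Tendsto ε F (𝓝 0) := hε'.mono_left hF
  have hb : ∀ n x, ‖W n (T x) - K (W n x)‖ ≤ ε n * ‖x‖ := by
    intro n x
    have := (K - conjOp (W n) T).le_opNorm (W n x)
    rw [(W n).norm_map] at this
    rw [ContinuousLinearMap.sub_apply, norm_sub_rev] at this
    have h5 : conjOp (W n) T (W n x) = W n (T x) := by simp [conjOp]
    rwa [h5] at this
  obtain ⟨L, hL⟩ := aux_L W F
  have hTA : ∀ x, T x ∈ auxA W F := aux_conv T K hK W ε F hε hb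
  refine ⟨auxA W F, auxA_closed W F, L, fun a => ⟨T a, hTA a⟩, fun a => rfl, ?_, ?_, ?_⟩
  · intro a
    refine tendsto_nhds_unique ?_ (hL ⟨T a, hTA a⟩)
    exact aux_transfer T K W ε F hε hb a _ ((K.continuous.tendsto _).comp (hL a))
  · intro x hx
    have h1 : adjoint T (T x) ∈ auxA W F := aux_conv2 T K hK W ε F hε hb x
    have h2 := hx _ h1
    rw [adjoint_inner_left] at h2
    exact inner_self_eq_zero.1 h2
  · intro x hx
    obtain ⟨y, hy⟩ := aux_conv2 K T hT (fun n => (W n).symm) ε F hε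
      (fun n => aux_symm T K (W n) (ε n) (hb n)) x
    have h1 : Tendsto (fun n => W n y) F (𝓝 (adjoint K (K x))) := by
      rw [tendsto_iff_norm_sub_tendsto_zero] at hy ⊢
      refine hy.congr fun n => ?_
      rw [← (W n).norm_map, map_sub, LinearIsometryEquiv.apply_symm_apply, norm_sub_rev]
    have h2 : L ⟨y, _, h1⟩ = adjoint K (K x) := tendsto_nhds_unique (hL _) h1
    have h3 := hx _ ⟨_, h2⟩
    rw [adjoint_inner_left] at h3
    exact inner_self_eq_zero.1 h3

noncomputable def auxInl : H →ₗᵢ[ℂ] WithLp 2 (H × H) where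
  toLinearMap := (WithLp.linearEquiv 2 ℂ (H × H)).symm.toLinearMap ∘ₗ LinearMap.inl ℂ H H
  norm_map' x := by
    rw [← sq_eq_sq₀ (by positivity) (by positivity), WithLp.prod_norm_sq_eq_of_L2]
    simp

theorem aux_inf {A : Submodule ℂ H} (hinf : ¬ FiniteDimensional ℂ H) (L : A →ₗᵢ[ℂ] H) :
    ¬ FiniteDimensional ℂ (LinearMap.range (auxInl.comp L).toLinearMap)ᗮ := by
  intro hfin
  apply hinf
  let g : H →ₗ[ℂ] WithLp 2 (H × H) :=
    (WithLp.linearEquiv 2 ℂ (H × H)).symm.toLinearMap ∘ₗ LinearMap.inr ℂ H H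
  have hg : ∀ x, g x ∈ (LinearMap.range (auxInl.comp L).toLinearMap)ᗮ := by
    rintro x _ ⟨a, rfl⟩
    simp [g, auxInl]
  refine Module.Finite.of_injective (g.codRestrict _ hg) ?_
  intro x y hxy
  have : g x = g y := congrArg Subtype.val hxy
  simpa [g] using this

theorem aux_perp {A : Submodule ℂ H} (L : A →ₗᵢ[ℂ] H) (v : WithLp 2 (H × H))
    (hv : v ∈ (LinearMap.range (auxInl.comp L).toLinearMap)ᗮ) :
    v.fst ∈ (LinearMap.range L.toLinearMap)ᗮ := by
  rintro _ ⟨a, rfl⟩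
  simpa [auxInl] using hv _ ⟨a, rfl⟩

theorem aux_dSum (T : H →L[ℂ] H) (v : WithLp 2 (H × H)) :
    dSum T (0 : H →L[ℂ] H) v = auxInl (T v.fst) := rfl

end lim

/-- If two compact operators `T` and `K` are approximately unitarily
equivalent, then `T ⊕ 0` and `K ⊕ 0` are unitarily equivalent. -/
theorem stmt11 {H : Type*} [NormedAddCommGroup H] [InnerProductSpace ℂ H] [CompleteSpace H]
    [TopologicalSpace.SeparableSpace H] (hinf : ¬ FiniteDimensional ℂ H)
    (T K : H →L[ℂ] H) (hT : IsCompactOperator T) (hK : IsCompactOperator K)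
    (h : ApproxUnitEquiv T K) :
    ∃ W : WithLp 2 (H × H) ≃ₗᵢ[ℂ] WithLp 2 (H × H),
      dSum K (0 : H →L[ℂ] H) = conjOp W (dSum T (0 : H →L[ℂ] H)) := by
  obtain ⟨A, hA, L, S, hS, hLS, hT0, hK0⟩ := aux_main_s11 T K hT hK h
  have : CompleteSpace A := hA.completeSpace_coe
  have hsep : TopologicalSpace.SeparableSpace (WithLp 2 (H × H)) :=
    (WithLp.prodContinuousLinearEquiv 2 ℂ H H).symm.surjective.denseRange.separableSpace
      (WithLp.prodContinuousLinearEquiv 2 ℂ H H).symm.continuous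
  obtain ⟨W, hW1, hW2⟩ := aux_glue (auxInl.comp A.subtypeₗᵢ) (auxInl.comp L)
    (aux_inf hinf _) (aux_inf hinf _)
  refine ⟨W, ?_⟩
  have key : ∀ v, dSum K (0 : H →L[ℂ] H) (W v) = W (dSum T (0 : H →L[ℂ] H) v) := by
    intro v
    have c₁ : CompleteSpace (LinearMap.range (auxInl.comp A.subtypeₗᵢ).toLinearMap) :=
      ((auxInl.comp A.subtypeₗᵢ).isometry.isUniformInducing.isComplete_range).completeSpace_coe
    obtain ⟨_, ⟨a, rfl⟩, x, hx, rfl⟩ :=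
      (LinearMap.range (auxInl.comp A.subtypeₗᵢ).toLinearMap).exists_add_mem_mem_orthogonal v
    have e1 : dSum T (0 : H →L[ℂ] H) x = 0 := by
      rw [aux_dSum, hT0, map_zero]
      have := aux_perp _ x hx
      rintro y hy
      exact this y ⟨⟨y, hy⟩, rfl⟩
    have e2 : dSum K (0 : H →L[ℂ] H) (W x) = 0 := by
      rw [aux_dSum, hK0 _ (aux_perp _ _ (hW2 x hx)), map_zero]
    rw [map_add, map_add, map_add, e1, e2, add_zero, add_zero]
    have e3 : dSum T (0 : H →L[ℂ] H) ((auxInl.comp A.subtypeₗᵢ) a)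
      = (auxInl.comp A.subtypeₗᵢ) (S a) := congrArg auxInl (hS a)
    have e4 : dSum K (0 : H →L[ℂ] H) ((auxInl.comp L) a)
      = (auxInl.comp L) (S a) := congrArg auxInl (hLS a)
    have e5 := hW1 a
    have e6 := hW1 (S a)
    change dSum K (0 : H →L[ℂ] H) (W ((auxInl.comp A.subtypeₗᵢ) a)) =
      W (dSum T (0 : H →L[ℂ] H) ((auxInl.comp A.subtypeₗᵢ) a))
    rw [e3, e5, e4, e6]
  ext1 v
  have := key (W.symm v)
  rw [W.apply_symm_apply] at this
  rw [this]
  rfl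
end
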